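/- Let n ≥ 1, 0 < s < 1, 1 ≤ p < ∞, and let F be a finite-dimensional real inner product space. There exists a constant C = C(n,s,p) > 0 (independent of R) such that for every 0 < R < ∞, every connection form Γ ∈ C¹ on the closed cylinder cl(B_R) × [0,R] ⊆ ℝ^{n+1} (B_R ⊆ ℝⁿ the open ball of radius R centred at 0) with values in L(ℝ^{n+1}, o(F)), every β ≥ ‖K_Γ‖_{L∞(B_R×(0,R))}, and every C¹ map U : B_R × [0,R] → F: ∬_{B_R×B_R} ‖U(x,0) − R^{Γ∥}(x,y) U(y,0)‖^p / |x−y|^{n+sp} dx dy ≤ C ∫_{B_R×(0,R)} (‖D_Γ U(z)‖^p + β^{p/2} ‖U(z)‖^p) / z_{n+1}^{1−(1−s)p} dz. -/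

import Mathlib

set_option synthInstance.maxHeartbeats 1000000
set_option maxHeartbeats 1000000

open Set MeasureTheory Metric
open scoped RealInnerProductSpace ENNReal

/-- The point `(x, t) ∈ ℝⁿ × ℝ ≅ ℝ^{n+1}`. -/
noncomputable def emb {n : ℕ} (x : EuclideanSpace ℝ (Fin n)) (t : ℝ) :
    EuclideanSpace ℝ (Fin (n + 1)) :=
  (EuclideanSpace.equiv (Fin (n + 1)) ℝ).symm
    (Fin.snoc ((EuclideanSpace.equiv (Fin n) ℝ) x) t)

/-- The Hilbert–Schmidt (Frobenius) norm of a continuous linear map from `ℝ^m` to `F`. -/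
noncomputable def hsNorm {m : ℕ} {F : Type*} [NormedAddCommGroup F] [InnerProductSpace ℝ F]
    (T : EuclideanSpace ℝ (Fin m) →L[ℝ] F) : ℝ :=
  Real.sqrt (∑ i : Fin m, ‖T (EuclideanSpace.single i (1 : ℝ))‖ ^ 2)

/-- The closed cylinder `cl(B_R) × [0, R] ⊆ ℝ^{n+1}`. -/
def closedCylinder (n : ℕ) (R : ℝ) : Set (EuclideanSpace ℝ (Fin (n + 1))) :=
  {z | ∃ x ∈ closedBall (0 : EuclideanSpace ℝ (Fin n)) R, ∃ t ∈ Icc (0:ℝ) R, z = emb x t}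

/-- The cylinder `B_R × [0, R] ⊆ ℝ^{n+1}` over the open ball. -/
def cylinder (n : ℕ) (R : ℝ) : Set (EuclideanSpace ℝ (Fin (n + 1))) :=
  {z | ∃ x ∈ ball (0 : EuclideanSpace ℝ (Fin n)) R, ∃ t ∈ Icc (0:ℝ) R, z = emb x t}

/-- Dyson series terms. -/
noncomputable def dyson {A : Type*} [NormedRing A] [NormedAlgebra ℝ A] (B : ℝ → A) : ℕ → ℝ → A
  | 0 => fun _ => 1
  | (k+1) => fun t => - ∫ r in (0:ℝ)..t, B r * dyson B k r

lemma dyson_cont {A : Type*} [NormedRing A] [NormedAlgebra ℝ A] [CompleteSpace A] (B : ℝ → A)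
    (hB : Continuous B) (k : ℕ) : Continuous (dyson B k) := by
  induction k with
  | zero => exact continuous_const
  | succ k ih =>
    simp only [dyson]
    exact (intervalIntegral.continuous_primitive
      (fun a b => (hB.mul ih).intervalIntegrable a b) 0).neg

lemma dyson_deriv {A : Type*} [NormedRing A] [NormedAlgebra ℝ A] [CompleteSpace A] (B : ℝ → A)
    (hB : Continuous B) (k : ℕ) (t : ℝ) :
    HasDerivAt (dyson B (k+1)) (- (B t * dyson B k t)) t := by
  simp only [dyson]
  exact ((hB.mul (dyson_cont B hB k)).integral_hasStrictDerivAt 0 t).hasDerivAt.fun_neg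

lemma dyson_bound {A : Type*} [NormedRing A] [NormedAlgebra ℝ A] [CompleteSpace A] (B : ℝ → A)
    (M : ℝ) (hM : ∀ t, ‖B t‖ ≤ M) (k : ℕ) :
    ∀ t, 0 ≤ t → ‖dyson B k t‖ ≤ ‖(1:A)‖ * ((M * t) ^ k / k.factorial) := by
  have hM0 : 0 ≤ M := (norm_nonneg _).trans (hM 0)
  induction k with
  | zero => intro t ht; simp [dyson]
  | succ k ih =>
    intro t ht
    simp only [dyson, norm_neg]
    have h1 : ‖∫ r in (0:ℝ)..t, B r * dyson B k r‖ ≤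
        ∫ r in (0:ℝ)..t, M * (‖(1:A)‖ * ((M * r) ^ k / k.factorial)) := by
      apply intervalIntegral.norm_integral_le_of_norm_le ht
      · filter_upwards with r hr
        exact (norm_mul_le _ _).trans (mul_le_mul (hM r) (ih r hr.1.le) (norm_nonneg _) hM0)
      · apply Continuous.intervalIntegrable; fun_prop
    refine h1.trans (le_of_eq ?_)
    have : ∀ r:ℝ, M * (‖(1:A)‖ * ((M * r) ^ k / k.factorial)) =
      (M^(k+1) * ‖(1:A)‖ / k.factorial) * r^k := by
      intro r; rw [mul_pow]; ring
    simp_rw [this]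
    rw [intervalIntegral.integral_const_mul, integral_pow, Nat.factorial_succ]
    push_cast
    field_simp
    ring

lemma exists_transport {A : Type*} [NormedRing A] [NormedAlgebra ℝ A] [CompleteSpace A] (B : ℝ → A)
    (hB : ContinuousOn B (Icc 0 1)) : ∃ P : ℝ → A, ContinuousOn P (Icc 0 1) ∧ P 0 = 1 ∧
      ∀ t ∈ Ioo (0:ℝ) 1, HasDerivAt P (-(B t * P t)) t := by
  set B' : ℝ → A := IccExtend (zero_le_one' ℝ) (domRestrict (Icc 0 1) B) with hB'
  have hc : Continuous B' := (continuousOn_iff_continuous_domRestrict.1 hB).Icc_extend'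
  obtain ⟨M, hM⟩ := isCompact_Icc.exists_bound_of_continuousOn hB
  have hM' : ∀ t, ‖B' t‖ ≤ M := fun t => hM _ (Subtype.mem _)
  have heq : ∀ t ∈ Icc (0:ℝ) 1, B' t = B t := fun t ht => by
    rw [hB', IccExtend_of_mem _ _ ht]; rfl
  have hM0 : 0 ≤ M := (norm_nonneg _).trans (hM' 0)
  have hsum : Summable fun k : ℕ => ‖(1:A)‖ * (M ^ k / k.factorial) :=
    (Real.summable_pow_div_factorial M).mul_left _
  have hbd : ∀ k, ∀ t ∈ Icc (0:ℝ) 1, ‖dyson B' k t‖ ≤ ‖(1:A)‖ * (M ^ k / k.factorial) := by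
    intro k t ht
    refine (dyson_bound B' M hM' k t ht.1).trans ?_
    have := ht.1
    have : M * t ≤ M := mul_le_of_le_one_right hM0 ht.2
    gcongr
  have hS : ∀ t ∈ Icc (0:ℝ) 1, Summable fun k => dyson B' k t := fun t ht =>
    Summable.of_norm_bounded hsum (fun k => hbd k t ht)
  refine ⟨fun t => ∑' k, dyson B' k t, ?_, ?_, ?_⟩
  · exact continuousOn_tsum (fun k => (dyson_cont B' hc k).continuousOn) hsum (fun k t ht => hbd k t ht)
  · show ∑' k, dyson B' k 0 = 1
    rw [tsum_eq_single 0]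
    · rfl
    · intro k hk
      obtain ⟨j, rfl⟩ := Nat.exists_eq_succ_of_ne_zero hk
      simp [dyson]
  · intro t ht
    have h1 : HasDerivAt (fun t => ∑' k, dyson B' (k+1) t) (∑' k, -(B' t * dyson B' k t)) t := by
      refine hasDerivAt_tsum_of_isPreconnected (t := Ioo 0 1) (y₀ := t)
        (hsum.mul_left M) isOpen_Ioo isPreconnected_Ioo
        (fun k y _ => dyson_deriv B' hc k y) ?_ ht ?_ ht
      · intro k y hy
        rw [norm_neg]
        exact (norm_mul_le _ _).trans
          (mul_le_mul (hM' y) (hbd k y ⟨hy.1.le, hy.2.le⟩) (norm_nonneg _) hM0)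
      · exact (summable_nat_add_iff 1).2 (hS t ⟨ht.1.le, ht.2.le⟩)
    have h2 : (∑' k, -(B' t * dyson B' k t)) = -(B t * ∑' k, dyson B' k t) := by
      rw [tsum_neg, (hS t ⟨ht.1.le, ht.2.le⟩).tsum_mul_left, heq t ⟨ht.1.le, ht.2.le⟩]
    rw [h2] at h1
    have h3 := h1.add_const (1:A)
    refine h3.congr_of_eventuallyEq ?_
    filter_upwards [isOpen_Ioo.mem_nhds ht] with r hr
    rw [(hS r ⟨hr.1.le, hr.2.le⟩).tsum_eq_zero_add, add_comm]
    rfl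


lemma const_of_deriv_zero {E : Type*} [NormedAddCommGroup E] [NormedSpace ℝ E] [CompleteSpace E]
    (f : ℝ → E)
    (hc : ContinuousOn f (Icc 0 1)) (hd : ∀ t ∈ Ioo (0:ℝ) 1, HasDerivAt f 0 t) :
    ∀ t ∈ Icc (0:ℝ) 1, f t = f 0 := by
  intro t ht
  have := intervalIntegral.integral_eq_sub_of_hasDerivAt_of_le ht.1
    (hc.mono (Icc_subset_Icc_right ht.2)) (fun x hx => hd x ⟨hx.1, hx.2.trans_le ht.2⟩) (by simp)
  simp only [intervalIntegral.integral_zero] at this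
  exact (sub_eq_zero.1 this.symm)

/-- `Q` is the transport back to the base point and `P` its inverse. -/
structure IsTr {F : Type*} [NormedAddCommGroup F] [InnerProductSpace ℝ F]
    (B P Q : ℝ → F →L[ℝ] F) : Prop where
  cP : ContinuousOn P (Icc 0 1)
  cQ : ContinuousOn Q (Icc 0 1)
  P0 : P 0 = 1
  Q0 : Q 0 = 1
  dP : ∀ t ∈ Ioo (0:ℝ) 1, HasDerivAt P (-(B t * P t)) t
  dQ : ∀ t ∈ Ioo (0:ℝ) 1, HasDerivAt Q (Q t * B t) t
  nP : ∀ t ∈ Icc (0:ℝ) 1, ∀ u, ‖P t u‖ = ‖u‖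
  nQ : ∀ t ∈ Icc (0:ℝ) 1, ∀ u, ‖Q t u‖ = ‖u‖
  PQ : ∀ t ∈ Icc (0:ℝ) 1, P t * Q t = 1
  QP : ∀ t ∈ Icc (0:ℝ) 1, Q t * P t = 1

lemma exists_isTr {F : Type*} [NormedAddCommGroup F] [InnerProductSpace ℝ F] [CompleteSpace F]
    [FiniteDimensional ℝ F] (B : ℝ → F →L[ℝ] F)
    (hB : ContinuousOn B (Icc 0 1))
    (hskew : ∀ t ∈ Icc (0:ℝ) 1, ∀ u w : F, ⟪B t u, w⟫ = -⟪u, B t w⟫) :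
    ∃ P Q, IsTr B P Q := by
  obtain ⟨P, cP, P0, dP⟩ := exists_transport B hB
  have hst : ∀ t ∈ Icc (0:ℝ) 1, star (B t) = - B t := by
    intro t ht
    rw [ContinuousLinearMap.star_eq_adjoint]
    ext u
    refine ext_inner_right ℝ fun w => ?_
    rw [ContinuousLinearMap.adjoint_inner_left]
    have := hskew t ht u w
    simp [inner_neg_left, this]
  have dQ : ∀ t ∈ Ioo (0:ℝ) 1, HasDerivAt (fun t => star (P t)) (star (P t) * B t) t := by
    intro t ht
    have := (dP t ht).star
    rw [star_neg, star_mul, hst t ⟨ht.1.le, ht.2.le⟩] at this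
    simpa using this
  have cQ : ContinuousOn (fun t => star (P t)) (Icc 0 1) := cP.star
  have QP : ∀ t ∈ Icc (0:ℝ) 1, star (P t) * P t = 1 := by
    intro t ht
    have := const_of_deriv_zero (fun t => star (P t) * P t) (cQ.mul cP) (fun t ht => by
      exact ((dQ t ht).mul (dP t ht)).congr_deriv (by noncomm_ring)) t ht
    simp only [this, P0, star_one, mul_one]
  have PQ : ∀ t ∈ Icc (0:ℝ) 1, P t * star (P t) = 1 := by
    intro t ht
    have h := QP t ht
    have h2 : ((star (P t) : F →L[ℝ] F) : F →ₗ[ℝ] F) * (P t : F →ₗ[ℝ] F) = 1 := by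
      ext u; exact congrArg (fun T : F →L[ℝ] F => T u) h
    have h3 := mul_eq_one_comm.1 h2
    ext u; exact congrArg (fun T : F →ₗ[ℝ] F => T u) h3
  have nn : ∀ T : F →L[ℝ] F, star T * T = 1 → ∀ u, ‖T u‖ = ‖u‖ := by
    intro T hT u
    have h1 : ⟪T u, T u⟫ = ⟪u, u⟫ := by
      rw [← ContinuousLinearMap.adjoint_inner_left, ← ContinuousLinearMap.star_eq_adjoint]
      have : (star T) (T u) = u := congrArg (fun T : F →L[ℝ] F => T u) hT
      rw [this]
    rw [real_inner_self_eq_norm_sq, real_inner_self_eq_norm_sq] at h1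
    exact (sq_eq_sq₀ (norm_nonneg _) (norm_nonneg _)).1 h1
  exact ⟨P, fun t => star (P t), cP, cQ, P0, by simp [P0], dP, dQ,
    fun t ht => nn _ (QP t ht), fun t ht => nn _ (by simpa using PQ t ht), PQ, QP⟩

lemma norm_le_one_of_isom {F : Type*} [NormedAddCommGroup F] [InnerProductSpace ℝ F]
    (T : F →L[ℝ] F) (h : ∀ u, ‖T u‖ = ‖u‖) : ‖T‖ ≤ 1 :=
  T.opNorm_le_bound zero_le_one (fun u => by rw [h u, one_mul])

lemma norm_sandwich {F : Type*} [NormedAddCommGroup F] [InnerProductSpace ℝ F]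
    (S T : F →L[ℝ] F) (X : F →L[ℝ] F) (c : ℝ)
    (h : ∀ u, ‖S u‖ = ‖u‖) (h' : ∀ u, ‖T u‖ = ‖u‖) (hX : ‖X‖ ≤ c) : ‖S * X * T‖ ≤ c := by
  refine (norm_mul_le _ _).trans ?_
  have h1 := norm_mul_le S X
  have h2 := norm_le_one_of_isom S h
  have h3 := norm_le_one_of_isom T h'
  calc ‖S * X‖ * ‖T‖ ≤ ‖S * X‖ * 1 := by gcongr
    _ ≤ ‖S‖ * ‖X‖ := by rw [mul_one]; exact h1
    _ ≤ 1 * c := by gcongr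
    _ = c := one_mul c

lemma duhamel {F : Type*} [NormedAddCommGroup F] [InnerProductSpace ℝ F] [CompleteSpace F]
    {B B' P Q P' Q' : ℝ → F →L[ℝ] F} (h : IsTr B P Q) (h' : IsTr B' P' Q')
    (hB : ContinuousOn B (Icc 0 1)) (hB' : ContinuousOn B' (Icc 0 1)) (t : ℝ)
    (ht : t ∈ Icc (0:ℝ) 1) :
    Q' t * P t - 1 = ∫ r in (0:ℝ)..t, Q' r * (B' r - B r) * P r := by
  have hsub : Icc 0 t ⊆ Icc (0:ℝ) 1 := Icc_subset_Icc_right ht.2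
  have := intervalIntegral.integral_eq_sub_of_hasDerivAt_of_le (f := fun r => Q' r * P r)
    (f' := fun r => Q' r * (B' r - B r) * P r) ht.1
    ((h'.cQ.mul h.cP).mono hsub) (fun x hx => by
      have hx' : x ∈ Ioo (0:ℝ) 1 := ⟨hx.1, hx.2.trans_le ht.2⟩
      exact ((h'.dQ x hx').mul (h.dP x hx')).congr_deriv (by noncomm_ring)) (by
      apply ContinuousOn.intervalIntegrable
      rw [uIcc_of_le ht.1]
      exact ((h'.cQ.mul (hB'.sub hB)).mul h.cP).mono hsub)
  rw [this]
  simp [h'.Q0, h.P0]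

lemma duhamel_bound {F : Type*} [NormedAddCommGroup F] [InnerProductSpace ℝ F] [CompleteSpace F]
    {B B' P Q P' Q' : ℝ → F →L[ℝ] F} (h : IsTr B P Q) (h' : IsTr B' P' Q')
    (hB : ContinuousOn B (Icc 0 1)) (hB' : ContinuousOn B' (Icc 0 1)) (c : ℝ)
    (hc : ∀ r ∈ Icc (0:ℝ) 1, ‖B' r - B r‖ ≤ c) (t : ℝ)
    (ht : t ∈ Icc (0:ℝ) 1) : ‖Q' t - Q t‖ ≤ c := by
  have hc0 : 0 ≤ c := (norm_nonneg _).trans (hc 0 (by simp))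
  have h1 : ‖Q' t * P t - 1‖ ≤ c := by
    rw [duhamel h h' hB hB' t ht]
    refine (intervalIntegral.norm_integral_le_of_norm_le_const (C := c) ?_).trans ?_
    · intro r hr
      rw [uIoc_of_le ht.1] at hr
      have hr' : r ∈ Icc (0:ℝ) 1 := ⟨hr.1.le, hr.2.trans ht.2⟩
      exact norm_sandwich _ _ _ _ (h'.nQ r hr') (h.nP r hr') (hc r hr')
    · rw [sub_zero, abs_of_nonneg ht.1]; exact mul_le_of_le_one_right hc0 ht.2
  have h2 : Q' t - Q t = 1 * (Q' t * P t - 1) * Q t := by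
    rw [one_mul, sub_mul, mul_assoc, h.PQ t ht]; simp
  rw [h2]
  exact norm_sandwich _ _ _ _ (fun u => by simp) (h.nQ t ht) h1


lemma param_deriv {F : Type*} [NormedAddCommGroup F] [InnerProductSpace ℝ F] [CompleteSpace F]
    {B P Q : ℝ → ℝ → F →L[ℝ] F} {B' : ℝ → F →L[ℝ] F} {L τ : ℝ} (hτ : τ ∈ Ioo (0:ℝ) 1)
    (hT : ∀ τ ∈ Icc (0:ℝ) 1, IsTr (B τ) (P τ) (Q τ))
    (hB : ∀ τ ∈ Icc (0:ℝ) 1, ContinuousOn (B τ) (Icc 0 1))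
    (hL : ∀ τ₁ ∈ Icc (0:ℝ) 1, ∀ τ₂ ∈ Icc (0:ℝ) 1, ∀ r ∈ Icc (0:ℝ) 1,
      ‖B τ₂ r - B τ₁ r‖ ≤ L * |τ₂ - τ₁|)
    (hB' : ∀ r ∈ Ioc (0:ℝ) 1, HasDerivAt (fun τ' => B τ' r) (B' r) τ) :
    HasDerivAt (fun τ' => Q τ' 1 * P τ 1) (∫ r in (0:ℝ)..1, Q τ r * B' r * P τ r) τ := by
  have hτ' : τ ∈ Icc (0:ℝ) 1 := ⟨hτ.1.le, hτ.2.le⟩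
  have h1 : (1:ℝ) ∈ Icc (0:ℝ) 1 := by simp
  have hev : ∀ᶠ τ' in nhdsWithin τ {τ}ᶜ, τ' ∈ Icc (0:ℝ) 1 :=
    nhdsWithin_le_nhds (Icc_mem_nhds hτ.1 hτ.2)
  rw [hasDerivAt_iff_tendsto_slope]
  have key : Filter.Tendsto (fun τ' => ∫ r in (0:ℝ)..1,
      Q τ' r * ((τ' - τ)⁻¹ • (B τ' r - B τ r)) * P τ r) (nhdsWithin τ {τ}ᶜ)
      (nhds (∫ r in (0:ℝ)..1, Q τ r * B' r * P τ r)) := by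
    apply intervalIntegral.tendsto_integral_filter_of_dominated_convergence (fun _ => L)
    · filter_upwards [hev] with τ' h
      apply ContinuousOn.aestronglyMeasurable _ measurableSet_uIoc
      rw [uIoc_of_le zero_le_one]
      have hb : ContinuousOn (fun r => B τ' r - B τ r) (Icc 0 1) := (hB τ' h).sub (hB τ hτ')
      have hsm : ContinuousOn (fun r => (τ' - τ)⁻¹ • (B τ' r - B τ r)) (Icc 0 1) :=
        hb.const_smul ((τ' - τ)⁻¹)
      have hq : ContinuousOn (fun r => Q τ' r * ((τ' - τ)⁻¹ • (B τ' r - B τ r))) (Icc 0 1) :=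
        (hT τ' h).cQ.mul hsm
      have hqp : ContinuousOn (fun r => Q τ' r * ((τ' - τ)⁻¹ • (B τ' r - B τ r)) * P τ r)
        (Icc 0 1) := hq.mul (hT τ hτ').cP
      exact hqp.mono Ioc_subset_Icc_self
    · filter_upwards [hev, self_mem_nhdsWithin] with τ' h hne
      filter_upwards with r hr
      rw [uIoc_of_le zero_le_one] at hr
      have hr' := Ioc_subset_Icc_self hr
      refine norm_sandwich _ _ _ _ ((hT τ' h).nQ r hr') ((hT τ hτ').nP r hr') ?_
      rw [norm_smul, norm_inv, Real.norm_eq_abs]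
      have h0 : 0 < |τ' - τ| := abs_pos.2 (sub_ne_zero.2 hne)
      rw [inv_mul_le_iff₀ h0, mul_comm]
      exact hL τ hτ' τ' h r hr'
    · simp
    · filter_upwards with r hr
      rw [uIoc_of_le zero_le_one] at hr
      have hr' := Ioc_subset_Icc_self hr
      have hq : Filter.Tendsto (fun τ' => Q τ' r) (nhdsWithin τ {τ}ᶜ) (nhds (Q τ r)) := by
        rw [tendsto_iff_norm_sub_tendsto_zero]
        have hz : Filter.Tendsto (fun τ' => L * |τ' - τ|) (nhdsWithin τ {τ}ᶜ) (nhds 0) := by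
          have : Continuous fun τ' => L * |τ' - τ| := by fun_prop
          have := (this.tendsto τ).mono_left (nhdsWithin_le_nhds (s := {τ}ᶜ))
          simpa using this
        refine squeeze_zero' (Filter.Eventually.of_forall fun _ => norm_nonneg _) ?_ hz
        filter_upwards [hev] with τ' h
        exact duhamel_bound (hT τ hτ') (hT τ' h) (hB τ hτ') (hB τ' h) _
          (fun r hr => hL τ hτ' τ' h r hr) r hr'
      have hb := hasDerivAt_iff_tendsto_slope.1 (hB' r hr)
      exact (hq.mul hb).mul tendsto_const_nhds
  refine key.congr' ?_
  filter_upwards [hev] with τ' h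
  rw [slope_def_module, (hT τ hτ').QP 1 h1, duhamel (hT τ hτ') (hT τ' h) (hB τ hτ') (hB τ' h) 1 h1,
    ← intervalIntegral.integral_smul]
  congr 1
  ext1 r
  simp

lemma gauge_identity {F : Type*} [NormedAddCommGroup F] [InnerProductSpace ℝ F] [CompleteSpace F]
    {B P Q B' A A' : ℝ → F →L[ℝ] F} {c : ℝ}
    (hT : IsTr B P Q) (hB : ContinuousOn B (Icc 0 1)) (hB' : ContinuousOn B' (Icc 0 1))
    (hA : ContinuousOn A (Icc 0 1)) (hA' : ContinuousOn A' (Icc 0 1)) (hA0 : A 0 = 0)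
    (hd : ∀ r ∈ Ioo (0:ℝ) 1, HasDerivAt A (A' r) r)
    (hk : ∀ r ∈ Ioc (0:ℝ) 1, ‖B' r - A' r + A r * B r - B r * A r‖ ≤ c) :
    ‖(∫ r in (0:ℝ)..1, Q r * B' r * P r) - Q 1 * A 1 * P 1‖ ≤ c := by
  have h1 : ∫ r in (0:ℝ)..1, Q r * (A' r - A r * B r + B r * A r) * P r = Q 1 * A 1 * P 1 := by
    have := intervalIntegral.integral_eq_sub_of_hasDerivAt_of_le (f := fun r => Q r * A r * P r)
      (f' := fun r => Q r * (A' r - A r * B r + B r * A r) * P r) zero_le_one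
      ((hT.cQ.mul hA).mul hT.cP) (fun x hx => by
        exact (((hT.dQ x hx).mul (hd x hx)).mul (hT.dP x hx)).congr_deriv (by
          simp only [Pi.mul_apply]; noncomm_ring)) (by
        apply ContinuousOn.intervalIntegrable
        rw [uIcc_of_le zero_le_one]
        exact (hT.cQ.mul ((hA'.sub (hA.mul hB)).add (hB.mul hA))).mul hT.cP)
    rw [this]; simp [hA0]
  rw [← h1, ← intervalIntegral.integral_sub]
  · have := intervalIntegral.norm_integral_le_of_norm_le_const (C := c) (a := 0) (b := 1)
      (f := fun r => Q r * B' r * P r - Q r * (A' r - A r * B r + B r * A r) * P r) (by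
        intro r hr
        rw [uIoc_of_le zero_le_one] at hr
        have hr' := Ioc_subset_Icc_self hr
        have e : Q r * B' r * P r - Q r * (A' r - A r * B r + B r * A r) * P r =
          Q r * (B' r - A' r + A r * B r - B r * A r) * P r := by noncomm_ring
        rw [e]
        exact norm_sandwich _ _ _ _ (hT.nQ r hr') (hT.nP r hr') (hk r hr))
    simpa using this
  · apply ContinuousOn.intervalIntegrable
    rw [uIcc_of_le zero_le_one]
    exact (hT.cQ.mul hB').mul hT.cP
  · apply ContinuousOn.intervalIntegrable
    rw [uIcc_of_le zero_le_one]
    exact (hT.cQ.mul ((hA'.sub (hA.mul hB)).add (hB.mul hA))).mul hT.cP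


lemma comp_aux {E G : Type*} [NormedAddCommGroup E] [NormedSpace ℝ E] [NormedAddCommGroup G]
    [NormedSpace ℝ G] {f : E → G} {f' : E →L[ℝ] G} {c : ℝ → E} {c' : E} {t : ℝ} {z : E}
    (hz : z = c t) (h : HasFDerivAt f f' z)
    (h' : HasDerivAt c c' t) : HasDerivAt (fun r => f (c r)) (f' c') t := by
  subst hz; exact h.comp_hasDerivAt t h'

lemma leg {E F : Type*} [NormedAddCommGroup E] [NormedSpace ℝ E]
    [NormedAddCommGroup F] [InnerProductSpace ℝ F] [CompleteSpace F]
    {K O : Set E} (hK : Convex ℝ K)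
    {Γ : E → E →L[ℝ] F →L[ℝ] F} {DΓ : E → E →L[ℝ] E →L[ℝ] F →L[ℝ] F}
    {U : E → F} {DU : E → E →L[ℝ] F} {Λ N β : ℝ}
    (hΓ : ∀ z ∈ O, HasFDerivAt Γ (DΓ z) z) (hΓc : ContinuousOn Γ K) (hDΓc : ContinuousOn DΓ K)
    (hΛ : ∀ z ∈ K, ∀ z' ∈ K, ‖Γ z' - Γ z‖ ≤ Λ * ‖z' - z‖) (hN : ∀ z ∈ K, ‖Γ z‖ ≤ N)
    (hβ : ∀ z ∈ O, ∀ v w : E, ‖DΓ z v w - DΓ z w v + (Γ z v).comp (Γ z w)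
            - (Γ z w).comp (Γ z v)‖ ≤ β * ‖v‖ * ‖w‖)
    (hU : ∀ z ∈ O, HasFDerivAt U (DU z) z)
    {X Y M : E} (hX : X ∈ K) (hY : Y ∈ K) (hM : M ∈ K)
    (hO : ∀ τ ∈ Ioo (0:ℝ) 1, ∀ r ∈ Ioc (0:ℝ) 1, X + r • ((Y + τ • (M - Y)) - X) ∈ O)
    (hUc : ContinuousOn (fun τ : ℝ => U (Y + τ • (M - Y))) (Icc 0 1))
    {P Q : E → ℝ → F →L[ℝ] F}
    (hT : ∀ z ∈ K, IsTr (fun r : ℝ => Γ (X + r • (z - X)) (z - X)) (P z) (Q z)) :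
    ContinuousOn (fun τ : ℝ => Q (Y + τ • (M - Y)) 1 (U (Y + τ • (M - Y)))) (Icc 0 1) ∧
    ∀ τ ∈ Ioo (0:ℝ) 1, ∃ V' : F,
      HasDerivAt (fun τ : ℝ => Q (Y + τ • (M - Y)) 1 (U (Y + τ • (M - Y)))) V' τ ∧
      ‖V'‖ ≤ ‖(DU (Y + τ • (M - Y)) + (Γ (Y + τ • (M - Y))).flip (U (Y + τ • (M - Y)))) (M - Y)‖
        + β * ‖M - Y‖ * ‖Y + τ • (M - Y) - X‖ * ‖U (Y + τ • (M - Y))‖ := by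
  set w : E := M - Y with hw
  set g : ℝ → E := fun τ => Y + τ • w with hg
  have hgK : ∀ τ ∈ Icc (0:ℝ) 1, g τ ∈ K := fun τ hτ => by
    have := hK.add_smul_sub_mem hY hM hτ
    exact this
  have hcK : ∀ τ ∈ Icc (0:ℝ) 1, ∀ r ∈ Icc (0:ℝ) 1, X + r • (g τ - X) ∈ K := fun τ hτ r hr =>
    hK.add_smul_sub_mem hX (hgK τ hτ) hr
  have h1 : (1:ℝ) ∈ Icc (0:ℝ) 1 := by simp
  have hΛ0 : 0 ≤ Λ * ‖w‖ := by
    have := (norm_nonneg (Γ M - Γ Y)).trans (hΛ Y hY M hM); exact this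
  have hN0 : 0 ≤ N := (norm_nonneg (Γ X)).trans (hN X hX)
  set B : ℝ → ℝ → F →L[ℝ] F := fun τ r => Γ (X + r • (g τ - X)) (g τ - X) with hBdef
  have hTr : ∀ τ ∈ Icc (0:ℝ) 1, IsTr (B τ) (P (g τ)) (Q (g τ)) := fun τ hτ => hT _ (hgK τ hτ)
  have hcc : ∀ τ ∈ Icc (0:ℝ) 1, ContinuousOn (fun r : ℝ => Γ (X + r • (g τ - X))) (Icc 0 1) :=
    fun τ hτ => hΓc.comp (by fun_prop) (fun r hr => hcK τ hτ r hr)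
  have hB : ∀ τ ∈ Icc (0:ℝ) 1, ContinuousOn (B τ) (Icc 0 1) := fun τ hτ =>
    (hcc τ hτ).clm_apply continuousOn_const
  set L : ℝ := Λ * ‖w‖ * (‖Y - X‖ + ‖w‖) + N * ‖w‖ with hLdef
  have hL : ∀ τ₁ ∈ Icc (0:ℝ) 1, ∀ τ₂ ∈ Icc (0:ℝ) 1, ∀ r ∈ Icc (0:ℝ) 1,
      ‖B τ₂ r - B τ₁ r‖ ≤ L * |τ₂ - τ₁| := by
    intro τ₁ h₁ τ₂ h₂ r hr
    have e : B τ₂ r - B τ₁ r = (Γ (X + r • (g τ₂ - X)) - Γ (X + r • (g τ₁ - X))) (g τ₂ - X)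
        + Γ (X + r • (g τ₁ - X)) (g τ₂ - g τ₁) := by
      simp only [hBdef, sub_apply, map_sub]; abel
    have e1 : g τ₂ - g τ₁ = (τ₂ - τ₁) • w := by simp only [hg]; module
    have e2 : ‖g τ₂ - X‖ ≤ ‖Y - X‖ + ‖w‖ := by
      have : g τ₂ - X = (Y - X) + τ₂ • w := by simp only [hg]; abel
      rw [this]
      refine (norm_add_le _ _).trans ?_
      gcongr
      rw [norm_smul, Real.norm_eq_abs, abs_of_nonneg h₂.1]
      exact mul_le_of_le_one_left (norm_nonneg _) h₂.2
    have e3 : ‖Γ (X + r • (g τ₂ - X)) - Γ (X + r • (g τ₁ - X))‖ ≤ Λ * ‖w‖ * |τ₂ - τ₁| := by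
      refine (hΛ _ (hcK τ₁ h₁ r hr) _ (hcK τ₂ h₂ r hr)).trans ?_
      have : X + r • (g τ₂ - X) - (X + r • (g τ₁ - X)) = (r * (τ₂ - τ₁)) • w := by
        simp only [hg]; module
      rw [this, norm_smul, norm_mul, Real.norm_eq_abs, Real.norm_eq_abs, abs_of_nonneg hr.1]
      have : 0 ≤ Λ * ‖w‖ * |τ₂ - τ₁| * (1 - r) := by
        have := hr.2
        have : 0 ≤ 1 - r := by linarith
        positivity
      nlinarith
    rw [e, e1]
    refine (norm_add_le _ _).trans ?_
    have f1 := ContinuousLinearMap.le_of_opNorm_le _ e3 (g τ₂ - X)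
    have f2 := ContinuousLinearMap.le_of_opNorm_le _ (hN _ (hcK τ₁ h₁ r hr)) ((τ₂ - τ₁) • w)
    rw [norm_smul, Real.norm_eq_abs] at f2
    have f3 : Λ * ‖w‖ * |τ₂ - τ₁| * ‖g τ₂ - X‖ ≤ Λ * ‖w‖ * |τ₂ - τ₁| * (‖Y - X‖ + ‖w‖) := by
      gcongr
    calc _ ≤ Λ * ‖w‖ * |τ₂ - τ₁| * (‖Y - X‖ + ‖w‖) + N * (|τ₂ - τ₁| * ‖w‖) :=
          add_le_add (f1.trans f3) f2
      _ = L * |τ₂ - τ₁| := by rw [hLdef]; ring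
  refine ⟨?_, ?_⟩
  · refine ContinuousOn.clm_apply ?_ hUc
    have : LipschitzOnWith (Real.toNNReal L) (fun τ => Q (g τ) 1) (Icc 0 1) := by
      refine LipschitzOnWith.of_dist_le_mul ?_
      intro τ₂ h₂ τ₁ h₁
      rw [dist_eq_norm, dist_eq_norm, Real.norm_eq_abs]
      refine (duhamel_bound (hTr τ₁ h₁) (hTr τ₂ h₂) (hB τ₁ h₁) (hB τ₂ h₂) _
        (fun r hr => hL τ₁ h₁ τ₂ h₂ r hr) 1 h1).trans ?_
      gcongr
      exact Real.le_coe_toNNReal L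
    exact this.continuousOn
  · intro τ hτ
    have hτ' : τ ∈ Icc (0:ℝ) 1 := ⟨hτ.1.le, hτ.2.le⟩
    have hgd : HasDerivAt g w τ :=
      (((hasDerivAt_id τ).smul_const w).const_add Y).congr_deriv (one_smul _ _)
    set c : ℝ → E := fun r => X + r • (g τ - X) with hcdef
    set B' : ℝ → F →L[ℝ] F := fun r => DΓ (c r) (r • w) (g τ - X) + Γ (c r) w with hB'def
    set A : ℝ → F →L[ℝ] F := fun r => Γ (c r) (r • w) with hAdef
    set A' : ℝ → F →L[ℝ] F := fun r => DΓ (c r) (g τ - X) (r • w) + Γ (c r) w with hA'def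
    have hcO : ∀ r ∈ Ioc (0:ℝ) 1, c r ∈ O := fun r hr => hO τ hτ r hr
    have hDc : ContinuousOn (fun r : ℝ => DΓ (c r)) (Icc 0 1) :=
      hDΓc.comp (by fun_prop) (fun r hr => hcK τ hτ' r hr)
    have hrw : ContinuousOn (fun r : ℝ => r • w) (Icc 0 1) := by fun_prop
    have hB'd : ∀ r ∈ Ioc (0:ℝ) 1, HasDerivAt (fun τ' => B τ' r) (B' r) τ := by
      intro r hr
      have d1 : HasDerivAt (fun τ' => X + r • (g τ' - X)) (r • w) τ :=
        ((hgd.sub_const X).const_smul r).const_add X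
      have d2 : HasDerivAt (fun τ' => Γ (X + r • (g τ' - X))) (DΓ (c r) (r • w)) τ :=
        comp_aux (G := E →L[ℝ] F →L[ℝ] F) rfl (hΓ (c r) (hcO r hr)) d1
      exact d2.clm_apply (hgd.sub_const X)
    have hpd := param_deriv (B := B) (P := fun τ => P (g τ)) (Q := fun τ => Q (g τ))
      hτ hTr hB hL hB'd
    have hgi := gauge_identity (A := A) (A' := A') (B' := B') (c := β * ‖w‖ * ‖g τ - X‖)
      (hTr τ hτ') (hB τ hτ')
      ((hDc.clm_apply hrw).clm_apply continuousOn_const |>.add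
        ((hcc τ hτ').clm_apply continuousOn_const))
      ((hcc τ hτ').clm_apply hrw)
      ((hDc.clm_apply continuousOn_const).clm_apply hrw |>.add
        ((hcc τ hτ').clm_apply continuousOn_const)) (by simp [hAdef]) (by
        intro r hr
        have d1 : HasDerivAt c (g τ - X) r :=
          (((hasDerivAt_id r).smul_const (g τ - X)).const_add X).congr_deriv (one_smul _ _)
        have d2 : HasDerivAt (fun r => Γ (c r)) (DΓ (c r) (g τ - X)) r :=
          comp_aux (G := E →L[ℝ] F →L[ℝ] F) rfl (hΓ (c r) (hcO r ⟨hr.1, hr.2.le⟩)) d1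
        have d3 : HasDerivAt (fun r : ℝ => r • w) w r := by
          simpa using (hasDerivAt_id r).smul_const w
        exact d2.clm_apply d3) (by
        intro r hr
        have := hβ (c r) (hcO r hr) (r • w) (g τ - X)
        have e : B' r - A' r + A r * B τ r - B τ r * A r =
          DΓ (c r) (r • w) (g τ - X) - DΓ (c r) (g τ - X) (r • w)
          + (Γ (c r) (r • w)).comp (Γ (c r) (g τ - X))
            - (Γ (c r) (g τ - X)).comp (Γ (c r) (r • w)) := by
          simp only [hB'def, hA'def, hAdef, hBdef, hcdef, ContinuousLinearMap.mul_def]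
          abel
        rw [e]
        refine this.trans ?_
        have hb0 : 0 ≤ β * ‖w‖ * ‖g τ - X‖ :=
          (norm_nonneg _).trans (hβ (c r) (hcO r hr) w (g τ - X))
        rw [norm_smul, Real.norm_eq_abs, abs_of_nonneg hr.1.le]
        have := mul_le_of_le_one_left hb0 hr.2
        linarith)
    have hc1 : c 1 = g τ := by simp [hcdef]
    have hgO : g τ ∈ O := by rw [← hc1]; exact hcO 1 (by simp)
    have hUd : HasDerivAt (fun τ' => U (g τ')) (DU (g τ) w) τ :=
      (hU _ hgO).comp_hasDerivAt τ hgd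
    set D := ∫ r in (0:ℝ)..1, Q (g τ) r * B' r * P (g τ) r with hD
    have hcomp : HasDerivAt (fun τ' => (Q (g τ') 1 * P (g τ) 1) (Q (g τ) 1 (U (g τ'))))
        (D (Q (g τ) 1 (U (g τ))) + (Q (g τ) 1 * P (g τ) 1) (Q (g τ) 1 (DU (g τ) w))) τ :=
      hpd.clm_apply ((Q (g τ) 1).hasFDerivAt.comp_hasDerivAt τ hUd)
    have hPQ := (hTr τ hτ').PQ 1 h1
    have hQP := (hTr τ hτ').QP 1 h1
    have hPQu : ∀ u, P (g τ) 1 (Q (g τ) 1 u) = u := fun u =>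
      congrArg (fun T : F →L[ℝ] F => T u) hPQ
    refine ⟨_, hcomp.congr_of_eventuallyEq (Filter.Eventually.of_forall fun τ' => ?_), ?_⟩
    · show Q (g τ') 1 (U (g τ')) = Q (g τ') 1 (P (g τ) 1 (Q (g τ) 1 (U (g τ'))))
      rw [hPQu]
    · rw [hQP]
      have e : D (Q (g τ) 1 (U (g τ))) + (1 : F →L[ℝ] F) (Q (g τ) 1 (DU (g τ) w)) =
          Q (g τ) 1 ((DU (g τ) + (Γ (g τ)).flip (U (g τ))) w)
          + (D - Q (g τ) 1 * A 1 * P (g τ) 1) (Q (g τ) 1 (U (g τ))) := by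
        have hm : (Q (g τ) 1 * A 1 * P (g τ) 1) (Q (g τ) 1 (U (g τ))) =
            Q (g τ) 1 (Γ (g τ) w (U (g τ))) := by
          show Q (g τ) 1 (A 1 (P (g τ) 1 (Q (g τ) 1 (U (g τ))))) = _
          rw [hPQu]
          simp only [hAdef, hc1, one_smul]
        rw [sub_apply, hm]
        simp only [add_apply, map_add, ContinuousLinearMap.flip_apply, one_apply_eq_self]
        abel
      rw [e]
      refine (norm_add_le _ _).trans ?_
      rw [(hTr τ hτ').nQ 1 h1]
      gcongr
      have := ContinuousLinearMap.le_of_opNorm_le _ hgi (Q (g τ) 1 (U (g τ)))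
      rw [(hTr τ hτ').nQ 1 h1] at this
      exact this


lemma ftc_norm {F : Type*} [NormedAddCommGroup F] [InnerProductSpace ℝ F]
    {f : ℝ → F} {φ : ℝ → ℝ} {a b : ℝ} (hab : a ≤ b) (hf : ContinuousOn f (Icc a b))
    (hφ : ContinuousOn φ (Icc a b)) (hφ0 : ∀ x ∈ Icc a b, 0 ≤ φ x)
    (hd : ∀ x ∈ Ioo a b, ∃ f', HasDerivAt f f' x ∧ ‖f'‖ ≤ φ x) :
    ‖f b - f a‖ ≤ ∫ x in a..b, φ x := by
  choose! f' hf' hle using hd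
  set w := f b - f a with hw
  have h := intervalIntegral.sub_le_integral_of_hasDeriv_right_of_le (g := fun x => ⟪f x, w⟫)
    (g' := fun x => ⟪f' x, w⟫) (φ := fun x => φ x * ‖w‖) hab
    (hf.inner continuousOn_const) (fun x hx => by
      have := (hf' x hx).inner ℝ (hasDerivAt_const x w)
      simpa using this.hasDerivWithinAt)
    ((hφ.mul continuousOn_const).integrableOn_Icc)
    (fun x hx => (real_inner_le_norm _ _).trans
      (mul_le_mul_of_nonneg_right (hle x hx) (norm_nonneg _)))
  rw [intervalIntegral.integral_mul_const] at h
  have h2 : ⟪f b, w⟫ - ⟪f a, w⟫ = ‖w‖ * ‖w‖ := by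
    rw [← inner_sub_left, ← hw, real_inner_self_eq_norm_mul_norm]
  simp only [h2] at h
  rcases (norm_nonneg w).eq_or_lt with h0 | h0
  · rw [← h0]
    exact intervalIntegral.integral_nonneg hab hφ0
  · exact le_of_mul_le_mul_right h h0

lemma cut_est {F : Type*} [NormedAddCommGroup F] [InnerProductSpace ℝ F]
    {V : ℝ → F} {g u : ℝ → ℝ} {β ρ : ℝ} (hβ : 0 ≤ β) (hρ : 0 < ρ) (hbig : 1 ≤ √β * ρ)
    (hV : ContinuousOn V (Icc 0 1)) (hg0 : ∀ τ, 0 ≤ g τ) (hu : ∀ τ ∈ Icc (0:ℝ) 1, ‖V τ‖ = u τ)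
    (hu0 : ∀ τ, 0 ≤ u τ)
    (hH : ContinuousOn (fun τ => g τ + √β * u τ) (Icc 0 1))
    (hd : ∀ τ ∈ Ioo (0:ℝ) 1, ∃ V', HasDerivAt V V' τ ∧
      ‖V'‖ ≤ g τ * ρ + β * ρ * (τ * ρ) * u τ) :
    ‖V 0‖ ≤ 2 * ρ * ∫ τ in (0:ℝ)..1, (g τ + √β * u τ) := by
  have hs : 0 < √β * ρ := by linarith
  set τ₀ := (√β * ρ)⁻¹ with hτ₀
  have hτ0 : 0 < τ₀ := inv_pos.2 hs
  have hτ1 : τ₀ ≤ 1 := inv_le_one_of_one_le₀ hbig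
  have hsub : Icc 0 τ₀ ⊆ Icc (0:ℝ) 1 := Icc_subset_Icc_right hτ1
  have hH0 : ∀ τ, 0 ≤ g τ + √β * u τ := fun τ => by
    have := hg0 τ; have := hu0 τ; positivity
  have hss : √β * √β = β := Real.mul_self_sqrt hβ
  have key := ftc_norm (f := fun τ => (1 - √β * ρ * τ) • V τ)
    (φ := fun τ => 2 * ρ * (g τ + √β * u τ)) hτ0.le
    (ContinuousOn.smul (by fun_prop) (hV.mono hsub))
    (continuousOn_const.mul (hH.mono hsub)) (fun x _ => by have := hH0 x; positivity) (by
      intro τ hτ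
      have hτ' : τ ∈ Ioo (0:ℝ) 1 := ⟨hτ.1, hτ.2.trans_le hτ1⟩
      obtain ⟨V', hV', hle⟩ := hd τ hτ'
      have d1 : HasDerivAt (fun τ => 1 - √β * ρ * τ) (-(√β * ρ)) τ := by
        simpa using ((hasDerivAt_id τ).const_mul (√β * ρ)).const_sub 1
      refine ⟨_, d1.smul hV', ?_⟩
      have hlt : √β * ρ * τ ≤ 1 := by
        have := mul_le_mul_of_nonneg_left hτ.2.le hs.le
        rwa [hτ₀, mul_inv_cancel₀ hs.ne'] at this
      have hge : 0 ≤ √β * ρ * τ := mul_nonneg hs.le hτ.1.le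
      refine (norm_add_le _ _).trans ?_
      rw [norm_smul, norm_smul, norm_neg, Real.norm_eq_abs, Real.norm_eq_abs, abs_of_nonneg hs.le,
        abs_of_nonneg (by linarith), hu τ ⟨hτ'.1.le, hτ'.2.le⟩]
      have e1 : (1 - √β * ρ * τ) * ‖V'‖ ≤ ‖V'‖ :=
        mul_le_of_le_one_left (norm_nonneg _) (by linarith)
      have e2 : β * ρ * (τ * ρ) * u τ ≤ √β * ρ * u τ := by
        have : β * ρ * (τ * ρ) * u τ = (√β * ρ * τ) * (√β * ρ * u τ) := by
          linear_combination (-(ρ * (τ * ρ) * u τ)) * hss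
        rw [this]
        exact mul_le_of_le_one_left (mul_nonneg hs.le (hu0 τ)) hlt
      have := mul_nonneg (hg0 τ) hρ.le
      nlinarith)
  have e0 : (1 - √β * ρ * τ₀) = 0 := by rw [hτ₀, mul_inv_cancel₀ hs.ne']; simp
  simp only [e0, zero_smul, mul_zero, sub_zero, one_smul, zero_sub, norm_neg] at key
  refine key.trans ?_
  rw [intervalIntegral.integral_const_mul]
  refine mul_le_mul_of_nonneg_left ?_ (by positivity)
  apply intervalIntegral.integral_mono_interval le_rfl hτ0.le hτ1
  · filter_upwards with τ using hH0 τ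
  · apply ContinuousOn.intervalIntegrable
    rwa [uIcc_of_le zero_le_one]

lemma pointwise {E F : Type*} [NormedAddCommGroup E] [NormedSpace ℝ E]
    [NormedAddCommGroup F] [InnerProductSpace ℝ F] [CompleteSpace F] [FiniteDimensional ℝ F]
    {K O : Set E} (hK : Convex ℝ K)
    (hKO : ∀ k ∈ K, ∀ m ∈ O, ∀ τ ∈ Ioc (0:ℝ) 1, k + τ • (m - k) ∈ O)
    {Γ : E → E →L[ℝ] F →L[ℝ] F} {DΓ : E → E →L[ℝ] E →L[ℝ] F →L[ℝ] F}
    {U : E → F} {DU : E → E →L[ℝ] F} {Λ N β : ℝ}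
    (hΓ : ∀ z ∈ O, HasFDerivAt Γ (DΓ z) z) (hΓc : ContinuousOn Γ K) (hDΓc : ContinuousOn DΓ K)
    (hΛ : ∀ z ∈ K, ∀ z' ∈ K, ‖Γ z' - Γ z‖ ≤ Λ * ‖z' - z‖) (hN : ∀ z ∈ K, ‖Γ z‖ ≤ N)
    (hskew : ∀ z ∈ K, ∀ (v : E) (u w : F), ⟪(Γ z v) u, w⟫ = -⟪u, (Γ z v) w⟫)
    (hβ0 : 0 ≤ β)
    (hβ : ∀ z ∈ O, ∀ v w : E, ‖DΓ z v w - DΓ z w v + (Γ z v).comp (Γ z w)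
            - (Γ z w).comp (Γ z v)‖ ≤ β * ‖v‖ * ‖w‖)
    (hU : ∀ z ∈ O, HasFDerivAt U (DU z) z)
    {G : E → ℝ} (hG0 : ∀ z, 0 ≤ G z)
    (hG : ∀ z v, ‖(DU z + (Γ z).flip (U z)) v‖ ≤ G z * ‖v‖)
    {X Y M : E} (hX : X ∈ K) (hY : Y ∈ K) (hMK : M ∈ K) (hM : M ∈ O)
    {ρ : ℝ} (hρ : 0 < ρ) (hρX : ‖M - X‖ ≤ ρ) (hρY : ‖M - Y‖ ≤ ρ)
    (hUX : ContinuousOn (fun τ : ℝ => U (X + τ • (M - X))) (Icc 0 1))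
    (hUY : ContinuousOn (fun τ : ℝ => U (Y + τ • (M - Y))) (Icc 0 1))
    (hHX : ContinuousOn (fun τ : ℝ => G (X + τ • (M - X)) + √β * ‖U (X + τ • (M - X))‖) (Icc 0 1))
    (hHY : ContinuousOn (fun τ : ℝ => G (Y + τ • (M - Y)) + √β * ‖U (Y + τ • (M - Y))‖) (Icc 0 1))
    {R : ℝ → F →L[ℝ] F} (hR1 : R 1 = 1) (hRc : ContinuousOn R (Icc 0 1))
    (hRd : ∀ t ∈ Ioo (0:ℝ) 1, HasDerivAt R (-(Γ (X + t • (Y - X)) (Y - X) * R t)) t) :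
    ‖U X - R 0 (U Y)‖ ≤ 3 * ρ * ((∫ τ in (0:ℝ)..1,
        (G (X + τ • (M - X)) + √β * ‖U (X + τ • (M - X))‖)) +
      ∫ τ in (0:ℝ)..1, (G (Y + τ • (M - Y)) + √β * ‖U (Y + τ • (M - Y))‖)) := by
  have h1 : (1:ℝ) ∈ Icc (0:ℝ) 1 := by simp
  have hex : ∀ X ∈ K, ∀ z, ∃ P Q, z ∈ K →
      IsTr (fun r : ℝ => Γ (X + r • (z - X)) (z - X)) P Q := by
    intro X hX z
    by_cases hz : z ∈ K
    · have hm : ∀ r ∈ Icc (0:ℝ) 1, X + r • (z - X) ∈ K := fun r hr =>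
        hK.add_smul_sub_mem hX hz hr
      obtain ⟨P, Q, h⟩ := exists_isTr (fun r : ℝ => Γ (X + r • (z - X)) (z - X))
        ((hΓc.comp (by fun_prop) hm).clm_apply continuousOn_const)
        (fun t ht => hskew _ (hm t ht) _)
      exact ⟨P, Q, fun _ => h⟩
    · exact ⟨0, 0, fun h => absurd h hz⟩
  have hOO : ∀ X ∈ K, ∀ Y ∈ K, ∀ τ ∈ Ioo (0:ℝ) 1, ∀ r ∈ Ioc (0:ℝ) 1,
      X + r • ((Y + τ • (M - Y)) - X) ∈ O := fun X hX Y hY τ hτ r hr =>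
    hKO X hX _ (hKO Y hY M hM τ ⟨hτ.1, hτ.2.le⟩) r hr
  choose P Q hT using fun z => hex X hX z
  choose P' Q' hT' using fun z => hex Y hY z
  -- the reference transport
  have hRQ : R 0 = Q Y 1 := by
    have hq := hT Y hY
    have := const_of_deriv_zero (fun t => Q Y t * R t) (hq.cQ.mul hRc) (fun t ht =>
      ((hq.dQ t ht).mul (hRd t ht)).congr_deriv (by noncomm_ring)) 1 h1
    simp only [hR1, hq.Q0, mul_one, one_mul] at this
    exact this.symm
  have hQX : ∀ u, Q X 1 u = u := by
    have hq := hT X hX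
    have := const_of_deriv_zero (fun t => Q X t) hq.cQ (fun t ht =>
      (hq.dQ t ht).congr_deriv (by simp)) 1 h1
    intro u
    rw [this, hq.Q0]; rfl
  have hQY : ∀ u, Q' Y 1 u = u := by
    have hq := hT' Y hY
    have := const_of_deriv_zero (fun t => Q' Y t) hq.cQ (fun t ht =>
      (hq.dQ t ht).congr_deriv (by simp)) 1 h1
    intro u
    rw [this, hq.Q0]; rfl
  obtain ⟨ca, da⟩ := leg hK hΓ hΓc hDΓc hΛ hN hβ hU hX hX hMK (hOO X hX X hX) hUX hT
  obtain ⟨cb, db⟩ := leg hK hΓ hΓc hDΓc hΛ hN hβ hU hX hY hMK (hOO X hX Y hY) hUY hT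
  obtain ⟨cc, dc⟩ := leg hK hΓ hΓc hDΓc hΛ hN hβ hU hY hY hMK (hOO Y hY Y hY) hUY hT'
  have hss : √β * √β = β := Real.mul_self_sqrt hβ0
  have hs0 : 0 ≤ √β := Real.sqrt_nonneg β
  have hH0 : ∀ z, 0 ≤ G z + √β * ‖U z‖ := fun z => by have := hG0 z; positivity
  have hIX : 0 ≤ ∫ τ in (0:ℝ)..1, (G (X + τ • (M - X)) + √β * ‖U (X + τ • (M - X))‖) :=
    intervalIntegral.integral_nonneg zero_le_one (fun τ _ => hH0 _)
  have hIY : 0 ≤ ∫ τ in (0:ℝ)..1, (G (Y + τ • (M - Y)) + √β * ‖U (Y + τ • (M - Y))‖) :=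
    intervalIntegral.integral_nonneg zero_le_one (fun τ _ => hH0 _)
  rcases le_total (√β * ρ) 1 with hsm | hbig
  · have hgen : ∀ Y ∈ K, ‖M - Y‖ ≤ ρ → 
        ∀ τ ∈ Ioo (0:ℝ) 1, ∀ c : ℝ, c ≤ ‖(DU (Y + τ • (M - Y)) +
          (Γ (Y + τ • (M - Y))).flip (U (Y + τ • (M - Y)))) (M - Y)‖
        + β * ‖M - Y‖ * ‖Y + τ • (M - Y) - X‖ * ‖U (Y + τ • (M - Y))‖ →
        c ≤ 3 * ρ * (G (Y + τ • (M - Y)) + √β * ‖U (Y + τ • (M - Y))‖) := by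
      intro Y hY hρY τ hτ c hc
      refine hc.trans ?_
      have e1 : ‖Y + τ • (M - Y) - X‖ ≤ 3 * ρ := by
        have : Y + τ • (M - Y) - X = (M - X) - (1 - τ) • (M - Y) := by module
        rw [this]
        refine (norm_sub_le _ _).trans ?_
        rw [norm_smul, Real.norm_eq_abs, abs_of_nonneg (by linarith [hτ.2])]
        have : (1 - τ) * ‖M - Y‖ ≤ ‖M - Y‖ :=
          mul_le_of_le_one_left (norm_nonneg _) (by linarith [hτ.1])
        linarith
      set z := Y + τ • (M - Y)
      have e2 := hG z (M - Y)
      have e3 : G z * ‖M - Y‖ ≤ G z * ρ := mul_le_mul_of_nonneg_left hρY (hG0 z)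
      have e4 : β * ‖M - Y‖ * ‖z - X‖ * ‖U z‖ ≤ β * ρ * (3 * ρ) * ‖U z‖ := by gcongr
      have e5 : β * ρ * (3 * ρ) * ‖U z‖ = (√β * ρ) * (3 * ρ * (√β * ‖U z‖)) := by
        linear_combination (-(3 * ρ * ρ * ‖U z‖)) * hss
      have e6 : (√β * ρ) * (3 * ρ * (√β * ‖U z‖)) ≤ 3 * ρ * (√β * ‖U z‖) :=
        mul_le_of_le_one_left (by positivity) hsm
      have := mul_nonneg (hG0 z) hρ.le
      nlinarith
    have fa := ftc_norm zero_le_one ca (continuousOn_const.mul hHX (f := fun _ => 3 * ρ))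
      (fun x _ => by
        have := hH0 (X + x • (M - X))
        simp only [Pi.mul_apply]; positivity) (fun τ hτ => by
        obtain ⟨V', h, h'⟩ := da τ hτ
        exact ⟨V', h, hgen X hX hρX τ hτ _ h'⟩)
    have fb := ftc_norm zero_le_one cb (continuousOn_const.mul hHY (f := fun _ => 3 * ρ))
      (fun x _ => by
        have := hH0 (Y + x • (M - Y))
        simp only [Pi.mul_apply]; positivity) (fun τ hτ => by
        obtain ⟨V', h, h'⟩ := db τ hτ
        exact ⟨V', h, hgen Y hY hρY τ hτ _ h'⟩)
    simp only [one_smul, add_sub_cancel, zero_smul, add_zero, Pi.mul_apply,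
      intervalIntegral.integral_const_mul, hQX] at fa fb
    rw [hRQ]
    calc ‖U X - Q Y 1 (U Y)‖ = ‖(Q M 1 (U M) - Q Y 1 (U Y)) - (Q M 1 (U M) - U X)‖ := by
          congr 1; abel
      _ ≤ _ := (norm_sub_le _ _).trans (by linarith)
  · have fa := cut_est (g := fun τ => G (X + τ • (M - X))) (u := fun τ => ‖U (X + τ • (M - X))‖)
      hβ0 hρ hbig ca (fun _ => hG0 _)
      (fun τ hτ => (hT _ (hK.add_smul_sub_mem hX hMK hτ)).nQ 1 h1 _)
      (fun _ => norm_nonneg _) hHX (fun τ hτ => by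
        obtain ⟨V', h, h'⟩ := da τ hτ
        refine ⟨V', h, h'.trans ?_⟩
        have e1 : ‖X + τ • (M - X) - X‖ ≤ τ * ρ := by
          rw [add_sub_cancel_left, norm_smul, Real.norm_eq_abs, abs_of_nonneg hτ.1.le]
          exact mul_le_mul_of_nonneg_left hρX hτ.1.le
        have := hG0 (X + τ • (M - X))
        refine add_le_add ((hG _ _).trans (by gcongr)) (by gcongr))
    have fc := cut_est (g := fun τ => G (Y + τ • (M - Y))) (u := fun τ => ‖U (Y + τ • (M - Y))‖)
      hβ0 hρ hbig cc (fun _ => hG0 _)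
      (fun τ hτ => (hT' _ (hK.add_smul_sub_mem hY hMK hτ)).nQ 1 h1 _)
      (fun _ => norm_nonneg _) hHY (fun τ hτ => by
        obtain ⟨V', h, h'⟩ := dc τ hτ
        refine ⟨V', h, h'.trans ?_⟩
        have e1 : ‖Y + τ • (M - Y) - Y‖ ≤ τ * ρ := by
          rw [add_sub_cancel_left, norm_smul, Real.norm_eq_abs, abs_of_nonneg hτ.1.le]
          exact mul_le_mul_of_nonneg_left hρY hτ.1.le
        have := hG0 (Y + τ • (M - Y))
        refine add_le_add ((hG _ _).trans (by gcongr)) (by gcongr))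
    simp only [zero_smul, add_zero, hQX, hQY] at fa fc
    rw [hRQ]
    refine (norm_sub_le _ _).trans ?_
    rw [(hT Y hY).nQ 1 h1]
    nlinarith

/-- Polar coordinates for radial functions, lower integral version. -/
lemma lintegral_radial {E : Type*} [NormedAddCommGroup E] [NormedSpace ℝ E] [MeasurableSpace E]
    [BorelSpace E] [FiniteDimensional ℝ E] [Nontrivial E] (μ : Measure E) [μ.IsAddHaarMeasure]
    {f : ℝ → ℝ≥0∞} (hf : Measurable f) :
    ∫⁻ x, f ‖x‖ ∂μ = μ.toSphere univ *
      ∫⁻ r in Ioi (0:ℝ), ENNReal.ofReal (r ^ (Module.finrank ℝ E - 1)) * f r := by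
  calc
    ∫⁻ x, f ‖x‖ ∂μ = ∫⁻ x : ({(0)}ᶜ : Set E), f (‖x.1‖) ∂(μ.comap (↑)) := by
      rw [lintegral_subtype_comap (measurableSet_singleton _).compl fun x ↦ f (‖x‖),
        restrict_compl_singleton]
    _ = ∫⁻ x, f x.2 ∂μ.toSphere.prod (.volumeIoiPow (Module.finrank ℝ E - 1)) := by
      have := μ.measurePreserving_homeomorphUnitSphereProd.lintegral_comp_emb
        (Homeomorph.measurableEmbedding _) (f ∘ Subtype.val ∘ Prod.snd)
      simpa using this
    _ = μ.toSphere univ * ∫⁻ x : Ioi (0 : ℝ), f x ∂.volumeIoiPow (Module.finrank ℝ E - 1) := by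
      rw [lintegral_prod _ (by fun_prop)]
      simp [mul_comm]
    _ = _ := by
      congr 1
      rw [Measure.volumeIoiPow, lintegral_withDensity_eq_lintegral_mul _ (by fun_prop) (by fun_prop)]
      exact lintegral_subtype_comap measurableSet_Ioi
        (fun r : ℝ => ENNReal.ofReal (r ^ (Module.finrank ℝ E - 1)) * f r)

/-- Scaling of a lower integral on the half line. -/
lemma lintegral_scale {c : ℝ} (hc : 0 < c) {f : ℝ → ℝ≥0∞} (hf : Measurable f) :
    ∫⁻ r in Ioi (0:ℝ), f (c * r) = ENNReal.ofReal c⁻¹ * ∫⁻ t in Ioi (0:ℝ), f t := by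
  have h1 : ∫⁻ r in Ioi (0:ℝ), f (c * r) = ∫⁻ r, (Ioi (0:ℝ)).indicator f (c * r) := by
    rw [← lintegral_indicator measurableSet_Ioi]
    refine lintegral_congr fun r => ?_
    simp only [indicator, mem_Ioi, mul_pos_iff_of_pos_left hc]
  have h2 := Real.map_volume_mul_left hc.ne'
  have hm : Measurable ((Ioi (0:ℝ)).indicator f) := hf.indicator measurableSet_Ioi
  rw [h1, ← lintegral_map (f := (Ioi (0:ℝ)).indicator f) (g := fun r => c * r) hm (by fun_prop), h2,
    lintegral_smul_measure, lintegral_indicator measurableSet_Ioi, abs_of_pos (inv_pos.2 hc),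
    smul_eq_mul]

lemma lintegral_tau {s : ℝ} (hs0 : 0 < s) :
    ∫⁻ τ in Ioo (0:ℝ) 1, ENNReal.ofReal (τ ^ (s - 1)) = ENNReal.ofReal (1 / s) := by
  have hi : IntervalIntegrable (fun τ : ℝ => τ ^ (s - 1)) volume 0 1 :=
    intervalIntegral.intervalIntegrable_rpow' (by linarith)
  have := integral_rpow (a := 0) (b := 1) (r := s - 1) (Or.inl (by linarith))
  rw [Measure.restrict_congr_set Ioo_ae_eq_Ioc, ← ofReal_integral_eq_lintegral_ofReal hi.1,
    ← intervalIntegral.integral_of_le zero_le_one, this]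
  · congr 1
    simp [Real.zero_rpow hs0.ne']
  · filter_upwards [ae_restrict_mem measurableSet_Ioc] with y hy
    exact Real.rpow_nonneg hy.1.le _

lemma core_double {n : ℕ} (hn : 1 ≤ n) {s p : ℝ} (hs0 : 0 < s)
    {Φ : EuclideanSpace ℝ (Fin n) × ℝ → ℝ≥0∞} (hΦ : Measurable Φ) :
    ∫⁻ x : EuclideanSpace ℝ (Fin n), ∫⁻ y : EuclideanSpace ℝ (Fin n), ∫⁻ τ in Ioo (0:ℝ) 1,
      ENNReal.ofReal (τ ^ ((1 - s) * (p - 1))) * (ENNReal.ofReal (‖y - x‖ ^ ((1 - s) * p - n)) *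
        Φ (x + (τ / 2) • (y - x), τ * ‖y - x‖ / 2))
    = (volume : Measure (EuclideanSpace ℝ (Fin n))).toSphere univ *
        ENNReal.ofReal (2 ^ ((1 - s) * p) * (1 / s)) *
      ∫⁻ t in Ioi (0:ℝ), ENNReal.ofReal (t ^ ((1 - s) * p - 1)) *
        ∫⁻ x : EuclideanSpace ℝ (Fin n), Φ (x, t) := by
  have : Nonempty (Fin n) := ⟨⟨0, hn⟩⟩
  set Ψ : ℝ → ℝ≥0∞ := fun t => ∫⁻ x : EuclideanSpace ℝ (Fin n), Φ (x, t) with hΨ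
  have hΨm : Measurable Ψ := by
    have : Measurable fun z : ℝ × EuclideanSpace ℝ (Fin n) => Φ (z.2, z.1) := by fun_prop
    exact this.lintegral_prod_right'
  set σ := (volume : Measure (EuclideanSpace ℝ (Fin n))).toSphere univ with hσ
  set I0 := ∫⁻ t in Ioi (0:ℝ), ENNReal.ofReal (t ^ ((1 - s) * p - 1)) * Ψ t with hI0
  -- translate in y
  have h1 : ∀ x : EuclideanSpace ℝ (Fin n), (∫⁻ y : EuclideanSpace ℝ (Fin n), ∫⁻ τ in Ioo (0:ℝ) 1,
      ENNReal.ofReal (τ ^ ((1 - s) * (p - 1))) * (ENNReal.ofReal (‖y - x‖ ^ ((1 - s) * p - n)) *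
        Φ (x + (τ / 2) • (y - x), τ * ‖y - x‖ / 2))) =
      ∫⁻ h : EuclideanSpace ℝ (Fin n), ∫⁻ τ in Ioo (0:ℝ) 1,
      ENNReal.ofReal (τ ^ ((1 - s) * (p - 1))) * (ENNReal.ofReal (‖h‖ ^ ((1 - s) * p - n)) *
        Φ (x + (τ / 2) • h, τ * ‖h‖ / 2)) := fun x =>
    lintegral_sub_right_eq_self (μ := volume) (fun h : EuclideanSpace ℝ (Fin n) =>
      ∫⁻ τ in Ioo (0:ℝ) 1,
      ENNReal.ofReal (τ ^ ((1 - s) * (p - 1))) * (ENNReal.ofReal (‖h‖ ^ ((1 - s) * p - n)) *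
        Φ (x + (τ / 2) • h, τ * ‖h‖ / 2))) x
  simp_rw [h1]
  rw [lintegral_lintegral_swap]
  swap
  · refine Measurable.aemeasurable ?_
    refine Measurable.lintegral_prod_right' (f := fun z : (EuclideanSpace ℝ (Fin n) ×
      EuclideanSpace ℝ (Fin n)) × ℝ => ENNReal.ofReal (z.2 ^ ((1 - s) * (p - 1))) *
        (ENNReal.ofReal (‖z.1.2‖ ^ ((1 - s) * p - n)) *
        Φ (z.1.1 + (z.2 / 2) • z.1.2, z.2 * ‖z.1.2‖ / 2))) ?_
    fun_prop
  have h2 : ∀ h : EuclideanSpace ℝ (Fin n), (∫⁻ x : EuclideanSpace ℝ (Fin n), ∫⁻ τ in Ioo (0:ℝ) 1,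
      ENNReal.ofReal (τ ^ ((1 - s) * (p - 1))) * (ENNReal.ofReal (‖h‖ ^ ((1 - s) * p - n)) *
        Φ (x + (τ / 2) • h, τ * ‖h‖ / 2))) =
      ∫⁻ τ in Ioo (0:ℝ) 1, ENNReal.ofReal (τ ^ ((1 - s) * (p - 1))) *
        (ENNReal.ofReal (‖h‖ ^ ((1 - s) * p - n)) * Ψ (τ * ‖h‖ / 2)) := by
    intro h
    rw [lintegral_lintegral_swap (by fun_prop)]
    refine lintegral_congr fun τ => ?_
    rw [lintegral_const_mul _ (by fun_prop), lintegral_const_mul _ (by fun_prop)]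
    congr 2
    exact lintegral_add_right_eq_self (μ := volume)
      (fun x : EuclideanSpace ℝ (Fin n) => Φ (x, τ * ‖h‖ / 2)) ((τ / 2) • h)
  simp_rw [h2]
  rw [lintegral_lintegral_swap (by fun_prop)]
  have h3 : ∀ τ ∈ Ioo (0:ℝ) 1, (∫⁻ h : EuclideanSpace ℝ (Fin n),
      ENNReal.ofReal (τ ^ ((1 - s) * (p - 1))) *
        (ENNReal.ofReal (‖h‖ ^ ((1 - s) * p - n)) * Ψ (τ * ‖h‖ / 2))) =
      ENNReal.ofReal (τ ^ (s - 1)) * (σ * ENNReal.ofReal (2 ^ ((1 - s) * p)) * I0) := by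
    intro τ hτ
    have hτ2 : 0 < τ / 2 := half_pos hτ.1
    rw [lintegral_const_mul _ (by fun_prop), lintegral_radial volume
      (f := fun r => ENNReal.ofReal (r ^ ((1 - s) * p - n)) * Ψ (τ * r / 2)) (by fun_prop)]
    have h4 : (∫⁻ r in Ioi (0:ℝ),
        ENNReal.ofReal (r ^ (Module.finrank ℝ (EuclideanSpace ℝ (Fin n)) - 1)) *
        (ENNReal.ofReal (r ^ ((1 - s) * p - n)) * Ψ (τ * r / 2))) =
        ENNReal.ofReal ((τ / 2) ^ (1 - (1 - s) * p)) * ∫⁻ r in Ioi (0:ℝ),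
          (fun t => ENNReal.ofReal (t ^ ((1 - s) * p - 1)) * Ψ t) (τ / 2 * r) := by
      rw [← lintegral_const_mul _ (by fun_prop)]
      refine setLIntegral_congr_fun measurableSet_Ioi fun r hr => ?_
      have hr : 0 < r := hr
      simp only
      rw [← mul_assoc, ← mul_assoc, ← ENNReal.ofReal_mul (by positivity),
        ← ENNReal.ofReal_mul (by positivity)]
      congr 2
      · rw [Real.mul_rpow hτ2.le hr.le, ← mul_assoc, ← Real.rpow_add hτ2,
          ← Real.rpow_natCast, ← Real.rpow_add hr]
        have : ((Module.finrank ℝ (EuclideanSpace ℝ (Fin n)) - 1 : ℕ) : ℝ) = (n:ℝ) - 1 := by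
          rw [finrank_euclideanSpace_fin, Nat.cast_sub hn, Nat.cast_one]
        rw [this]
        rw [show 1 - (1 - s) * p + ((1 - s) * p - 1) = 0 by ring, Real.rpow_zero, one_mul]
        congr 1; ring
      · congr 1; ring
    rw [h4, lintegral_scale (f := fun t => ENNReal.ofReal (t ^ ((1 - s) * p - 1)) * Ψ t) hτ2
      (by fun_prop), ← hI0, ← hσ]
    have h5 : τ ^ ((1 - s) * (p - 1)) * ((τ / 2) ^ (1 - (1 - s) * p) * (τ / 2)⁻¹) =
        τ ^ (s - 1) * 2 ^ ((1 - s) * p) := by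
      rw [← Real.rpow_neg_one (τ / 2), ← Real.rpow_add hτ2, Real.div_rpow hτ.1.le (by norm_num),
        div_eq_mul_inv, ← mul_assoc, ← Real.rpow_add hτ.1, ← Real.rpow_neg (by norm_num)]
      congr 2 <;> ring
    have h6 : ENNReal.ofReal (τ ^ ((1 - s) * (p - 1))) *
        (ENNReal.ofReal ((τ / 2) ^ (1 - (1 - s) * p)) * ENNReal.ofReal ((τ / 2)⁻¹)) =
        ENNReal.ofReal (τ ^ (s - 1)) * ENNReal.ofReal (2 ^ ((1 - s) * p)) := by
      have := hτ.1
      rw [← ENNReal.ofReal_mul (by positivity), ← ENNReal.ofReal_mul (by positivity), h5,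
        ENNReal.ofReal_mul (by positivity)]
    calc _ = (ENNReal.ofReal (τ ^ ((1 - s) * (p - 1))) *
        (ENNReal.ofReal ((τ / 2) ^ (1 - (1 - s) * p)) * ENNReal.ofReal ((τ / 2)⁻¹))) * (σ * I0) := by
          ring
      _ = _ := by rw [h6]; ring
  rw [setLIntegral_congr_fun measurableSet_Ioo h3, lintegral_mul_const _ (by fun_prop),
    lintegral_tau hs0, ENNReal.ofReal_mul (by positivity)]
  ring

lemma jensen_tau {s p : ℝ} (hs0 : 0 < s) (hp : 1 ≤ p) {H : ℝ → ℝ≥0∞}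
    (hH : AEMeasurable H (volume.restrict (Ioo (0:ℝ) 1))) :
    (∫⁻ τ in Ioo (0:ℝ) 1, H τ) ^ p ≤ ENNReal.ofReal ((1 / s) ^ (p - 1)) *
      ∫⁻ τ in Ioo (0:ℝ) 1, ENNReal.ofReal (τ ^ ((1 - s) * (p - 1))) * H τ ^ p := by
  rcases hp.eq_or_lt with rfl | hp1
  · simp
  have hpq : p.HolderConjugate (p.conjExponent) := Real.HolderConjugate.conjExponent hp1
  have hp0 : 0 < p := by linarith
  set q := p.conjExponent with hq
  have hqe : q = p / (p - 1) := rfl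
  have hp10 : p - 1 ≠ 0 := by linarith
  set f : ℝ → ℝ≥0∞ := fun τ => ENNReal.ofReal (τ ^ ((1 - s) * (p - 1) / p)) * H τ with hf
  set g : ℝ → ℝ≥0∞ := fun τ => ENNReal.ofReal (τ ^ (-((1 - s) * (p - 1) / p))) with hg
  have hfm : AEMeasurable f (volume.restrict (Ioo (0:ℝ) 1)) :=
    AEMeasurable.mul (by fun_prop) hH
  have hgm : AEMeasurable g (volume.restrict (Ioo (0:ℝ) 1)) := by fun_prop
  have h1 := ENNReal.lintegral_mul_le_Lp_mul_Lq (volume.restrict (Ioo (0:ℝ) 1)) hpq hfm hgm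
  have e1 : ∫⁻ τ in Ioo (0:ℝ) 1, (f * g) τ = ∫⁻ τ in Ioo (0:ℝ) 1, H τ := by
    refine setLIntegral_congr_fun measurableSet_Ioo fun τ hτ => ?_
    simp only [Pi.mul_apply, hf, hg]
    have h0 := hτ.1
    rw [mul_right_comm, ← ENNReal.ofReal_mul (by positivity), ← Real.rpow_add h0]
    simp
  have e2 : ∫⁻ τ in Ioo (0:ℝ) 1, f τ ^ p =
      ∫⁻ τ in Ioo (0:ℝ) 1, ENNReal.ofReal (τ ^ ((1 - s) * (p - 1))) * H τ ^ p := by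
    refine setLIntegral_congr_fun measurableSet_Ioo fun τ hτ => ?_
    have h0 := hτ.1
    simp only [hf]
    rw [ENNReal.mul_rpow_of_nonneg _ _ hp0.le, ENNReal.ofReal_rpow_of_nonneg (by positivity) hp0.le,
      ← Real.rpow_mul h0.le, div_mul_cancel₀ _ hp0.ne']
  have e3 : ∫⁻ τ in Ioo (0:ℝ) 1, g τ ^ q = ENNReal.ofReal (1 / s) := by
    rw [← lintegral_tau hs0]
    refine setLIntegral_congr_fun measurableSet_Ioo fun τ hτ => ?_
    have h0 := hτ.1
    simp only [hg]
    rw [ENNReal.ofReal_rpow_of_nonneg (by positivity) (by rw [hqe]; exact div_nonneg hp0.le (by linarith)),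
      ← Real.rpow_mul h0.le, hqe]
    congr 2
    field_simp
    ring
  rw [e1, e2, e3] at h1
  refine (ENNReal.rpow_le_rpow h1 hp0.le).trans (le_of_eq ?_)
  rw [ENNReal.mul_rpow_of_nonneg _ _ hp0.le, ← ENNReal.rpow_mul, ← ENNReal.rpow_mul,
    one_div_mul_cancel hp0.ne', ENNReal.rpow_one, mul_comm]
  congr 1
  rw [ENNReal.ofReal_rpow_of_pos (by positivity), hqe]
  congr 2
  field_simp

/-- The horizontal projection. -/
noncomputable def prj {n : ℕ} (z : EuclideanSpace ℝ (Fin (n + 1))) : EuclideanSpace ℝ (Fin n) :=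
  WithLp.toLp 2 (fun i => z i.castSucc)

lemma emb_castSucc {n : ℕ} (x : EuclideanSpace ℝ (Fin n)) (t : ℝ) (i : Fin n) :
    emb x t i.castSucc = x i := by
  simp [emb, EuclideanSpace.equiv]

lemma emb_last {n : ℕ} (x : EuclideanSpace ℝ (Fin n)) (t : ℝ) :
    emb x t (Fin.last n) = t := by
  simp [emb, EuclideanSpace.equiv]

lemma prj_emb {n : ℕ} (x : EuclideanSpace ℝ (Fin n)) (t : ℝ) : prj (emb x t) = x := by
  ext i; simp [prj, emb_castSucc]

lemma emb_prj {n : ℕ} (z : EuclideanSpace ℝ (Fin (n + 1))) : emb (prj z) (z (Fin.last n)) = z := by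
  ext i
  refine Fin.lastCases ?_ (fun j => ?_) i
  · simp [emb_last]
  · simp [prj, emb_castSucc]

lemma emb_sub {n : ℕ} (x y : EuclideanSpace ℝ (Fin n)) (t r : ℝ) :
    emb x t - emb y r = emb (x - y) (t - r) := by
  ext i
  refine Fin.lastCases ?_ (fun j => ?_) i
  · simp [emb_last]
  · simp [emb_castSucc]

lemma emb_add {n : ℕ} (x y : EuclideanSpace ℝ (Fin n)) (t r : ℝ) :
    emb x t + emb y r = emb (x + y) (t + r) := by
  ext i
  refine Fin.lastCases ?_ (fun j => ?_) i
  · simp [emb_last]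
  · simp [emb_castSucc]

lemma smul_emb {n : ℕ} (x : EuclideanSpace ℝ (Fin n)) (t c : ℝ) :
    c • emb x t = emb (c • x) (c * t) := by
  ext i
  refine Fin.lastCases ?_ (fun j => ?_) i
  · simp [emb_last]
  · simp [emb_castSucc]

lemma norm_emb_sq {n : ℕ} (x : EuclideanSpace ℝ (Fin n)) (t : ℝ) :
    ‖emb x t‖ ^ 2 = ‖x‖ ^ 2 + t ^ 2 := by
  rw [EuclideanSpace.norm_sq_eq, EuclideanSpace.norm_sq_eq, Fin.sum_univ_castSucc]
  simp [emb_last, emb_castSucc]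

lemma continuous_emb {n : ℕ} :
    Continuous (fun q : EuclideanSpace ℝ (Fin n) × ℝ => emb q.1 q.2) := by
  unfold emb
  refine (EuclideanSpace.equiv (Fin (n + 1)) ℝ).symm.continuous.comp ?_
  refine continuous_pi fun i => ?_
  refine Fin.lastCases ?_ (fun j => ?_) i
  · simpa using continuous_snd
  · simp only [Fin.snoc_castSucc]
    exact (continuous_apply j).comp
      ((EuclideanSpace.equiv (Fin n) ℝ).continuous.comp continuous_fst)

lemma continuous_prj {n : ℕ} : Continuous (prj (n := n)) := by
  unfold prj; fun_prop

/-- The open cylinder. -/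
def openCyl (n : ℕ) (R : ℝ) : Set (EuclideanSpace ℝ (Fin (n + 1))) :=
  {z | prj z ∈ ball (0 : EuclideanSpace ℝ (Fin n)) R ∧ z (Fin.last n) ∈ Ioo (0:ℝ) R}

lemma isOpen_openCyl (n : ℕ) (R : ℝ) : IsOpen (openCyl n R) :=
  (isOpen_ball.preimage continuous_prj).inter
    (isOpen_Ioo.preimage (by fun_prop : Continuous fun z : EuclideanSpace ℝ (Fin (n + 1)) =>
      z (Fin.last n)))

lemma mem_closedCylinder {n : ℕ} {R : ℝ} {z : EuclideanSpace ℝ (Fin (n + 1))} :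
    z ∈ closedCylinder n R ↔ prj z ∈ closedBall (0 : EuclideanSpace ℝ (Fin n)) R ∧
      z (Fin.last n) ∈ Icc (0:ℝ) R := by
  constructor
  · rintro ⟨x, hx, t, ht, rfl⟩
    rw [prj_emb, emb_last]; exact ⟨hx, ht⟩
  · rintro ⟨h1, h2⟩
    exact ⟨_, h1, _, h2, (emb_prj z).symm⟩

lemma openCyl_subset_closed {n : ℕ} {R : ℝ} : openCyl n R ⊆ closedCylinder n R := fun _ hz =>
  mem_closedCylinder.2 ⟨ball_subset_closedBall hz.1, Ioo_subset_Icc_self hz.2⟩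

lemma openCyl_subset_cyl {n : ℕ} {R : ℝ} : openCyl n R ⊆ cylinder n R := fun z hz =>
  ⟨_, hz.1, _, Ioo_subset_Icc_self hz.2, (emb_prj z).symm⟩

lemma convex_closedCylinder (n : ℕ) (R : ℝ) : Convex ℝ (closedCylinder n R) := by
  intro x hx y hy a b ha hb hab
  rw [mem_closedCylinder] at *
  have e : prj (a • x + b • y) = a • prj x + b • prj y := by
    ext i; simp [prj]
  rw [e]
  refine ⟨convex_closedBall _ _ hx.1 hy.1 ha hb hab, ?_⟩
  simpa using convex_Icc _ _ hx.2 hy.2 ha hb hab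

lemma isCompact_closedCylinder (n : ℕ) (R : ℝ) : IsCompact (closedCylinder n R) := by
  have : closedCylinder n R = Set.image (fun q : EuclideanSpace ℝ (Fin n) × ℝ => emb q.1 q.2)
      (closedBall (0 : EuclideanSpace ℝ (Fin n)) R ×ˢ Icc (0:ℝ) R) := by
    ext z
    constructor
    · rintro ⟨x, hx, t, ht, rfl⟩
      exact ⟨(x, t), ⟨hx, ht⟩, rfl⟩
    · rintro ⟨⟨x, t⟩, ⟨hx, ht⟩, rfl⟩
      exact ⟨x, hx, t, ht, rfl⟩
  rw [this]
  exact ((isCompact_closedBall _ _).prod isCompact_Icc).image continuous_emb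

lemma openCyl_star {n : ℕ} {R : ℝ} : ∀ k ∈ closedCylinder n R, ∀ m ∈ openCyl n R,
    ∀ τ ∈ Ioc (0:ℝ) 1, k + τ • (m - k) ∈ openCyl n R := by
  intro k hk m hm τ hτ
  rw [mem_closedCylinder] at hk
  have e : prj (k + τ • (m - k)) = (1 - τ) • prj k + τ • prj m := by
    ext i; simp [prj]; ring
  obtain ⟨hτ0, hτ1⟩ := hτ
  obtain ⟨hk1, hk2, hk3⟩ := hk
  obtain ⟨hm1, hm2, hm3⟩ := hm
  rw [mem_closedBall_zero_iff] at hk1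
  rw [mem_ball_zero_iff] at hm1
  refine ⟨?_, ?_⟩
  · rw [e, mem_ball_zero_iff]
    refine (norm_add_le _ _).trans_lt ?_
    rw [norm_smul, norm_smul, Real.norm_of_nonneg hτ0.le, Real.norm_of_nonneg (by linarith)]
    nlinarith
  · simp only [PiLp.add_apply, PiLp.smul_apply, PiLp.sub_apply, smul_eq_mul, mem_Ioo]
    constructor <;> nlinarith

lemma hsNorm_nonneg {m : ℕ} {F : Type*} [NormedAddCommGroup F] [InnerProductSpace ℝ F]
    (T : EuclideanSpace ℝ (Fin m) →L[ℝ] F) : 0 ≤ hsNorm T := Real.sqrt_nonneg _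

lemma le_hsNorm {m : ℕ} {F : Type*} [NormedAddCommGroup F] [InnerProductSpace ℝ F]
    (T : EuclideanSpace ℝ (Fin m) →L[ℝ] F) (v : EuclideanSpace ℝ (Fin m)) :
    ‖T v‖ ≤ hsNorm T * ‖v‖ := by
  have hv : v = ∑ i, v i • EuclideanSpace.single i (1:ℝ) := by
    simpa using ((EuclideanSpace.basisFun (Fin m) ℝ).sum_repr v).symm
  have h1 : T v = ∑ i, v i • T (EuclideanSpace.single i (1:ℝ)) := by
    conv_lhs => rw [hv]
    simp [map_sum]
  have h2 : ‖T v‖ ≤ ∑ i, ‖T (EuclideanSpace.single i (1:ℝ))‖ * ‖v i‖ := by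
    rw [h1]
    refine (norm_sum_le _ _).trans (Finset.sum_le_sum fun i _ => ?_)
    rw [norm_smul, mul_comm]
  refine h2.trans ((Real.sum_mul_le_sqrt_mul_sqrt _ _ _).trans ?_)
  rw [EuclideanSpace.norm_eq]
  rfl

lemma continuous_hsNorm {m : ℕ} {F : Type*} [NormedAddCommGroup F] [InnerProductSpace ℝ F] :
    Continuous (hsNorm : (EuclideanSpace ℝ (Fin m) →L[ℝ] F) → ℝ) := by
  unfold hsNorm
  fun_prop

/-- Points of the inclined segment stay in the cylinder. -/
lemma seg_mem_ball {n : ℕ} {R : ℝ} {x y : EuclideanSpace ℝ (Fin n)}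
    (hx : x ∈ ball (0 : EuclideanSpace ℝ (Fin n)) R)
    (hy : y ∈ ball (0 : EuclideanSpace ℝ (Fin n)) R) {τ : ℝ} (hτ : τ ∈ Icc (0:ℝ) 1) :
    x + (τ / 2) • (y - x) ∈ ball (0 : EuclideanSpace ℝ (Fin n)) R :=
  (convex_ball _ _).add_smul_sub_mem hx hy ⟨by linarith [hτ.1], by linarith [hτ.2]⟩

lemma dist_lt_two {n : ℕ} {R : ℝ} {x y : EuclideanSpace ℝ (Fin n)}
    (hx : x ∈ ball (0 : EuclideanSpace ℝ (Fin n)) R)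
    (hy : y ∈ ball (0 : EuclideanSpace ℝ (Fin n)) R) : ‖y - x‖ < 2 * R := by
  rw [mem_ball_zero_iff] at hx hy
  linarith [norm_sub_le y x]

lemma seg_continuous {n : ℕ} {R : ℝ} (hR : 0 < R) {α : Type*} [TopologicalSpace α]
    {f : EuclideanSpace ℝ (Fin (n + 1)) → α} (hf : ContinuousOn f (cylinder n R))
    {x y : EuclideanSpace ℝ (Fin n)}
    (hx : x ∈ ball (0 : EuclideanSpace ℝ (Fin n)) R)
    (hy : y ∈ ball (0 : EuclideanSpace ℝ (Fin n)) R) :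
    ContinuousOn (fun τ : ℝ => f (emb (x + (τ / 2) • (y - x)) (τ * ‖y - x‖ / 2))) (Icc 0 1) := by
  refine hf.comp (f := fun τ : ℝ => emb (x + (τ / 2) • (y - x)) (τ * ‖y - x‖ / 2)) ?_ ?_
  · exact (continuous_emb.comp (g := fun q : EuclideanSpace ℝ (Fin n) × ℝ => emb q.1 q.2)
      (f := fun τ : ℝ => (x + (τ / 2) • (y - x), τ * ‖y - x‖ / 2)) (by fun_prop)).continuousOn
  · intro τ hτ
    have := dist_lt_two hx hy
    have h0 := norm_nonneg (y - x)
    have h1 := hτ.1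
    have h2 := hτ.2
    exact ⟨_, seg_mem_ball hx hy hτ, _, ⟨by positivity, by nlinarith⟩, rfl⟩

lemma exists_lip {E W : Type*} [NormedAddCommGroup E] [NormedSpace ℝ E] [NormedAddCommGroup W]
    [NormedSpace ℝ W] {K : Set E} (hK : IsCompact K) (hc : Convex ℝ K) {f : E → W}
    {f' : E → E →L[ℝ] W} (hf : ∀ z ∈ K, HasFDerivWithinAt f (f' z) K z) (hf' : ContinuousOn f' K) :
    ∃ Λ : ℝ, ∀ z ∈ K, ∀ z' ∈ K, ‖f z' - f z‖ ≤ Λ * ‖z' - z‖ := by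
  obtain ⟨Λ, hΛ⟩ := hK.exists_bound_of_continuousOn (E := E →L[ℝ] W) hf'
  exact ⟨Λ, fun z hz z' hz' => hc.norm_image_sub_le_of_norm_hasFDerivWithin_le hf hΛ hz hz'⟩

lemma pw_final {F : Type*} [NormedAddCommGroup F] [InnerProductSpace ℝ F] [FiniteDimensional ℝ F]
    {n : ℕ} {R : ℝ} (hR : 0 < R)
    {Γ : EuclideanSpace ℝ (Fin (n + 1)) → EuclideanSpace ℝ (Fin (n + 1)) →L[ℝ] F →L[ℝ] F}
    {DΓ : EuclideanSpace ℝ (Fin (n + 1)) →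
          EuclideanSpace ℝ (Fin (n + 1)) →L[ℝ] EuclideanSpace ℝ (Fin (n + 1)) →L[ℝ] F →L[ℝ] F}
    (hΓ : ∀ z ∈ closedCylinder n R, HasFDerivWithinAt Γ (DΓ z) (closedCylinder n R) z)
    (hΓc : ContinuousOn Γ (closedCylinder n R))
    (hDΓc : ContinuousOn DΓ (closedCylinder n R))
    (hskew : ∀ z ∈ closedCylinder n R, ∀ (v : EuclideanSpace ℝ (Fin (n + 1))) (u w : F),
          ⟪(Γ z v) u, w⟫ = -⟪u, (Γ z v) w⟫)
    {β : ℝ} (hβ0 : 0 ≤ β)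
    (hβ : ∀ x ∈ ball (0 : EuclideanSpace ℝ (Fin n)) R, ∀ t ∈ Ioo (0:ℝ) R,
          ∀ v w : EuclideanSpace ℝ (Fin (n + 1)),
          ‖((DΓ (emb x t)) v) w - ((DΓ (emb x t)) w) v
            + ((Γ (emb x t)) v).comp ((Γ (emb x t)) w)
            - ((Γ (emb x t)) w).comp ((Γ (emb x t)) v)‖ ≤ β * ‖v‖ * ‖w‖)
    {U : EuclideanSpace ℝ (Fin (n + 1)) → F}
    {DU : EuclideanSpace ℝ (Fin (n + 1)) → EuclideanSpace ℝ (Fin (n + 1)) →L[ℝ] F}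
    (hU : ∀ z ∈ cylinder n R, HasFDerivWithinAt U (DU z) (cylinder n R) z)
    {H : EuclideanSpace ℝ (Fin (n + 1)) → ℝ}
    (hH : H = fun z => hsNorm (DU z + (Γ z).flip (U z)) + √β * ‖U z‖)
    (hHc : ContinuousOn H (cylinder n R))
    {x y : EuclideanSpace ℝ (Fin n)}
    (hx : x ∈ ball (0 : EuclideanSpace ℝ (Fin n)) R)
    (hy : y ∈ ball (0 : EuclideanSpace ℝ (Fin n)) R) (hxy : x ≠ y)
    {P : ℝ → F →L[ℝ] F} (hP1 : P 1 = ContinuousLinearMap.id ℝ F)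
    (hP : ∀ t ∈ Icc (0:ℝ) 1, HasDerivWithinAt P
            (-((Γ (emb ((1 - t) • x + t • y) 0)) (emb (y - x) 0)).comp (P t))
            (Icc (0:ℝ) 1) t) :
    ‖U (emb x 0) - P 0 (U (emb y 0))‖ ≤ 3 * ‖y - x‖ *
      ((∫ τ in (0:ℝ)..1, H (emb (x + (τ / 2) • (y - x)) (τ * ‖y - x‖ / 2))) +
        ∫ τ in (0:ℝ)..1, H (emb (y + (τ / 2) • (x - y)) (τ * ‖y - x‖ / 2))) := by
  have := FiniteDimensional.complete ℝ F
  have hr : 0 < ‖y - x‖ := norm_pos_iff.2 (sub_ne_zero.2 hxy.symm)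
  have hr2 := dist_lt_two hx hy
  set M : EuclideanSpace ℝ (Fin (n + 1)) := emb (x + (1 / 2 : ℝ) • (y - x)) (‖y - x‖ / 2) with hM
  have hsymm : ‖x - y‖ = ‖y - x‖ := norm_sub_rev _ _
  have hM' : M = emb (y + (1 / 2 : ℝ) • (x - y)) (‖y - x‖ / 2) := by
    rw [hM]; congr 1
    rw [← sub_eq_zero]; module
  have hMO : M ∈ openCyl n R := by
    refine ⟨?_, ?_⟩
    · rw [hM, prj_emb]; exact seg_mem_ball hx hy ⟨zero_le_one, le_rfl⟩
    · rw [hM, emb_last]; exact ⟨by linarith, by linarith⟩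
  have hX : emb x 0 ∈ closedCylinder n R :=
    ⟨x, ball_subset_closedBall hx, 0, ⟨le_rfl, hR.le⟩, rfl⟩
  have hY : emb y 0 ∈ closedCylinder n R :=
    ⟨y, ball_subset_closedBall hy, 0, ⟨le_rfl, hR.le⟩, rfl⟩
  have segX : ∀ τ : ℝ, emb x 0 + τ • (M - emb x 0) =
      emb (x + (τ / 2) • (y - x)) (τ * ‖y - x‖ / 2) := by
    intro τ
    rw [hM, emb_sub, smul_emb, emb_add]
    congr 1
    · module
    · ring
  have segY : ∀ τ : ℝ, emb y 0 + τ • (M - emb y 0) =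
      emb (y + (τ / 2) • (x - y)) (τ * ‖y - x‖ / 2) := by
    intro τ
    rw [hM', emb_sub, smul_emb, emb_add]
    congr 1
    · module
    · ring
  have nX : ‖M - emb x 0‖ ≤ ‖y - x‖ := by
    rw [hM, emb_sub]
    refine abs_le_of_sq_le_sq' ?_ hr.le |>.2
    rw [norm_emb_sq, add_sub_cancel_left, norm_smul, Real.norm_of_nonneg (by norm_num)]
    nlinarith
  have nY : ‖M - emb y 0‖ ≤ ‖y - x‖ := by
    rw [hM', emb_sub]
    refine abs_le_of_sq_le_sq' ?_ hr.le |>.2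
    rw [norm_emb_sq, add_sub_cancel_left, norm_smul, Real.norm_of_nonneg (by norm_num), hsymm]
    nlinarith
  obtain ⟨N, hN⟩ := (isCompact_closedCylinder n R).exists_bound_of_continuousOn
    (E := EuclideanSpace ℝ (Fin (n + 1)) →L[ℝ] F →L[ℝ] F) hΓc
  obtain ⟨Λ, hΛ⟩ := exists_lip (W := EuclideanSpace ℝ (Fin (n + 1)) →L[ℝ] F →L[ℝ] F)
    (isCompact_closedCylinder n R) (convex_closedCylinder n R) hΓ hDΓc
  have hUc : ContinuousOn U (cylinder n R) := fun z hz => (hU z hz).continuousWithinAt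
  have main := pointwise (K := closedCylinder n R) (O := openCyl n R)
    (convex_closedCylinder n R) openCyl_star (Γ := Γ) (DΓ := DΓ) (U := U) (DU := DU)
    (Λ := Λ) (N := N) (β := β)
    (fun z hz => (hΓ z (openCyl_subset_closed hz)).hasFDerivAt
      (Filter.mem_of_superset ((isOpen_openCyl n R).mem_nhds hz) openCyl_subset_closed))
    hΓc hDΓc
    hΛ
    hN hskew hβ0
    (fun z hz v w => by
      have := hβ (prj z) hz.1 (z (Fin.last n)) hz.2 v w
      rwa [emb_prj] at this)
    (fun z hz => (hU z (openCyl_subset_cyl hz)).hasFDerivAt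
      (Filter.mem_of_superset ((isOpen_openCyl n R).mem_nhds hz) openCyl_subset_cyl))
    (G := fun z => hsNorm (DU z + (Γ z).flip (U z)))
    (fun z => hsNorm_nonneg _) (fun z v => le_hsNorm _ v)
    hX hY (openCyl_subset_closed hMO) hMO hr nX nY
    (by simp only [segX]; exact seg_continuous hR hUc hx hy)
    (by simp only [segY]; rw [← hsymm]; exact seg_continuous hR hUc hy hx)
    (by
      have := seg_continuous hR hHc hx hy
      rw [hH] at this
      simp only [segX]; exact this)
    (by
      have := seg_continuous hR hHc hy hx
      rw [hH, hsymm] at this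
      simp only [segY]; exact this)
    (R := P) hP1 (fun t ht => (hP t ht).continuousWithinAt)
    (fun t ht => by
      have h1 := (hP t (Ioo_subset_Icc_self ht)).hasDerivAt (Icc_mem_nhds ht.1 ht.2)
      have e1 : emb x 0 + t • (emb y 0 - emb x 0) = emb ((1 - t) • x + t • y) 0 := by
        rw [emb_sub, smul_emb, emb_add]
        congr 1
        · module
        · ring
      have e2 : emb y 0 - emb x 0 = emb (y - x) 0 := by rw [emb_sub, sub_zero]
      rw [e1, e2]
      refine h1.congr_deriv ?_
      ext v
      simp)
  simp only [segX, segY] at main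
  rw [hH]
  exact main

/-- The constant of the pointwise estimate. -/
noncomputable def kap (s p : ℝ) : ℝ≥0∞ :=
  ENNReal.ofReal (3 ^ p) * 2 ^ (p - 1) * ENNReal.ofReal ((1 / s) ^ (p - 1))

lemma kap_ne_top {s p : ℝ} (hp : 1 ≤ p) : kap s p ≠ ⊤ := by
  unfold kap
  have : (2 : ℝ≥0∞) ^ (p - 1) ≠ ⊤ := ENNReal.rpow_ne_top_of_nonneg (by linarith) (by simp)
  exact ENNReal.mul_ne_top (ENNReal.mul_ne_top ENNReal.ofReal_ne_top this) ENNReal.ofReal_ne_top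

lemma ofReal_int_eq {h : ℝ → ℝ} (hc : ContinuousOn h (Icc 0 1)) (h0 : ∀ τ, 0 ≤ h τ) :
    ENNReal.ofReal (∫ τ in (0:ℝ)..1, h τ) = ∫⁻ τ in Ioo (0:ℝ) 1, ENNReal.ofReal (h τ) := by
  have hi : IntervalIntegrable h volume 0 1 := by
    apply ContinuousOn.intervalIntegrable
    rwa [uIcc_of_le zero_le_one]
  rw [Measure.restrict_congr_set Ioo_ae_eq_Ioc, ← ofReal_integral_eq_lintegral_ofReal hi.1,
    ← intervalIntegral.integral_of_le zero_le_one]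
  exact Filter.Eventually.of_forall h0

lemma pw_pow {s p r e b D : ℝ} (hs0 : 0 < s) (hp : 1 ≤ p) (hr : 0 < r) (hb : b = p - e)
    (hD : 0 ≤ D) {h1 h2 : ℝ → ℝ} (c1 : ContinuousOn h1 (Icc 0 1)) (c2 : ContinuousOn h2 (Icc 0 1))
    (n1 : ∀ τ, 0 ≤ h1 τ) (n2 : ∀ τ, 0 ≤ h2 τ)
    (hDl : D ≤ 3 * r * ((∫ τ in (0:ℝ)..1, h1 τ) + ∫ τ in (0:ℝ)..1, h2 τ)) :
    ENNReal.ofReal (D ^ p / r ^ e) ≤ kap s p *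
      ((∫⁻ τ in Ioo (0:ℝ) 1, ENNReal.ofReal (τ ^ ((1 - s) * (p - 1))) *
        (ENNReal.ofReal (r ^ b) * ENNReal.ofReal (h1 τ) ^ p)) +
      ∫⁻ τ in Ioo (0:ℝ) 1, ENNReal.ofReal (τ ^ ((1 - s) * (p - 1))) *
        (ENNReal.ofReal (r ^ b) * ENNReal.ofReal (h2 τ) ^ p)) := by
  have hp0 : 0 ≤ p := by linarith
  have key : ∀ h : ℝ → ℝ, ContinuousOn h (Icc 0 1) → (∀ τ, 0 ≤ h τ) →
      ENNReal.ofReal (r ^ b) * ENNReal.ofReal (∫ τ in (0:ℝ)..1, h τ) ^ p ≤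
      ENNReal.ofReal ((1 / s) ^ (p - 1)) *
      ∫⁻ τ in Ioo (0:ℝ) 1, ENNReal.ofReal (τ ^ ((1 - s) * (p - 1))) *
        (ENNReal.ofReal (r ^ b) * ENNReal.ofReal (h τ) ^ p) := by
    intro h c n
    have hm : AEMeasurable (fun τ => ENNReal.ofReal (h τ)) (volume.restrict (Ioo (0:ℝ) 1)) :=
      ((c.mono Ioo_subset_Icc_self).aemeasurable measurableSet_Ioo).ennreal_ofReal
    have := jensen_tau hs0 hp hm
    rw [ofReal_int_eq c n]
    calc _ ≤ ENNReal.ofReal (r ^ b) * (ENNReal.ofReal ((1 / s) ^ (p - 1)) *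
      ∫⁻ τ in Ioo (0:ℝ) 1, ENNReal.ofReal (τ ^ ((1 - s) * (p - 1))) *
        ENNReal.ofReal (h τ) ^ p) := by gcongr
      _ = _ := by
        rw [mul_left_comm, ← lintegral_const_mul' _ _ ENNReal.ofReal_ne_top]
        congr 1
        refine lintegral_congr fun τ => ?_
        ring
  set I1 := ∫ τ in (0:ℝ)..1, h1 τ with hI1
  set I2 := ∫ τ in (0:ℝ)..1, h2 τ with hI2
  have p1 : 0 ≤ I1 := intervalIntegral.integral_nonneg zero_le_one fun τ _ => n1 τ
  have p2 : 0 ≤ I2 := intervalIntegral.integral_nonneg zero_le_one fun τ _ => n2 τ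
  have e1 : D ^ p / r ^ e ≤ 3 ^ p * (r ^ b * (I1 + I2) ^ p) := by
    have hre : 0 < r ^ e := Real.rpow_pos_of_pos hr _
    rw [div_le_iff₀ hre]
    refine (Real.rpow_le_rpow hD hDl hp0).trans (le_of_eq ?_)
    rw [Real.mul_rpow (by positivity) (by positivity), Real.mul_rpow (by positivity) (by positivity),
      hb, Real.rpow_sub hr]
    field_simp
  calc _ ≤ ENNReal.ofReal (3 ^ p * (r ^ b * (I1 + I2) ^ p)) := ENNReal.ofReal_le_ofReal e1
    _ = ENNReal.ofReal (3 ^ p) * (ENNReal.ofReal (r ^ b) *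
        (ENNReal.ofReal I1 + ENNReal.ofReal I2) ^ p) := by
      rw [ENNReal.ofReal_mul (by positivity), ENNReal.ofReal_mul (by positivity),
        ← ENNReal.ofReal_rpow_of_nonneg (add_nonneg p1 p2) hp0, ENNReal.ofReal_add p1 p2]
    _ ≤ ENNReal.ofReal (3 ^ p) * (ENNReal.ofReal (r ^ b) *
        (2 ^ (p - 1) * (ENNReal.ofReal I1 ^ p + ENNReal.ofReal I2 ^ p))) := by
      gcongr
      exact ENNReal.rpow_add_le_mul_rpow_add_rpow _ _ hp
    _ = ENNReal.ofReal (3 ^ p) * 2 ^ (p - 1) * (ENNReal.ofReal (r ^ b) * ENNReal.ofReal I1 ^ p +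
        ENNReal.ofReal (r ^ b) * ENNReal.ofReal I2 ^ p) := by ring
    _ ≤ _ := by
      refine (mul_le_mul_right (add_le_add (key h1 c1 n1) (key h2 c2 n2)) _).trans (le_of_eq ?_)
      unfold kap
      ring

lemma fin_pow {s p t G u β : ℝ} (hp : 1 ≤ p) (ht : 0 < t) (hG : 0 ≤ G)
    (hu : 0 ≤ u) (hβ : 0 ≤ β) :
    ENNReal.ofReal (t ^ ((1 - s) * p - 1)) * ENNReal.ofReal (G + √β * u) ^ p ≤
      2 ^ (p - 1) * ENNReal.ofReal ((G ^ p + β ^ (p / 2) * u ^ p) / t ^ (1 - (1 - s) * p)) := by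
  have hp0 : 0 ≤ p := by linarith
  have h1 : ENNReal.ofReal (G + √β * u) ^ p ≤
      2 ^ (p - 1) * ENNReal.ofReal (G ^ p + β ^ (p / 2) * u ^ p) := by
    rw [ENNReal.ofReal_add hG (by positivity)]
    refine (ENNReal.rpow_add_le_mul_rpow_add_rpow _ _ hp).trans (le_of_eq ?_)
    rw [ENNReal.ofReal_add (by positivity) (by positivity), ENNReal.ofReal_rpow_of_nonneg hG hp0,
      ENNReal.ofReal_rpow_of_nonneg (by positivity) hp0, Real.mul_rpow (by positivity) hu,
      Real.sqrt_eq_rpow, ← Real.rpow_mul hβ]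
    congr 5
    ring_nf
  refine (mul_le_mul_right h1 _).trans (le_of_eq ?_)
  have h2 : t ^ ((1 - s) * p - 1) = (t ^ (1 - (1 - s) * p))⁻¹ := by
    rw [← Real.rpow_neg ht.le]; congr 1; ring
  rw [mul_left_comm, ← ENNReal.ofReal_mul (by positivity), h2, inv_mul_eq_div]

/-- The truncated density. -/
noncomputable def PhiD (n : ℕ) (R p : ℝ) (H : EuclideanSpace ℝ (Fin (n + 1)) → ℝ) :
    EuclideanSpace ℝ (Fin n) × ℝ → ℝ≥0∞ :=
  (ball (0 : EuclideanSpace ℝ (Fin n)) R ×ˢ Ioo (0:ℝ) R).indicator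
    (fun q => ENNReal.ofReal (H (emb q.1 q.2)) ^ p)

lemma measurable_PhiD {n : ℕ} {R p : ℝ} {H : EuclideanSpace ℝ (Fin (n + 1)) → ℝ}
    (hHc : ContinuousOn H (cylinder n R)) : Measurable (PhiD n R p H) := by
  classical
  unfold PhiD
  rw [← piecewise_eq_indicator]
  refine ContinuousOn.measurable_piecewise ?_ continuousOn_const
    (measurableSet_ball.prod measurableSet_Ioo)
  refine (ENNReal.continuous_rpow_const.comp ENNReal.continuous_ofReal).comp_continuousOn
    (hHc.comp (f := fun q : EuclideanSpace ℝ (Fin n) × ℝ => emb q.1 q.2)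
      continuous_emb.continuousOn ?_)
  rintro ⟨x, t⟩ ⟨hx, ht⟩
  exact ⟨x, hx, t, Ioo_subset_Icc_self ht, rfl⟩

/-- The inner integral along inclined segments. -/
noncomputable def Aint (n : ℕ) (R s p : ℝ) (H : EuclideanSpace ℝ (Fin (n + 1)) → ℝ)
    (x y : EuclideanSpace ℝ (Fin n)) : ℝ≥0∞ :=
  ∫⁻ τ in Ioo (0:ℝ) 1,
      ENNReal.ofReal (τ ^ ((1 - s) * (p - 1))) * (ENNReal.ofReal (‖y - x‖ ^ ((1 - s) * p - n)) *
        PhiD n R p H (x + (τ / 2) • (y - x), τ * ‖y - x‖ / 2))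

lemma measurable_Aint {n : ℕ} {R s p : ℝ} {H : EuclideanSpace ℝ (Fin (n + 1)) → ℝ}
    (hHc : ContinuousOn H (cylinder n R)) :
    Measurable (fun q : EuclideanSpace ℝ (Fin n) × EuclideanSpace ℝ (Fin n) =>
      Aint n R s p H q.1 q.2) := by
  have := measurable_PhiD (p := p) hHc
  unfold Aint
  refine Measurable.lintegral_prod_right' (f := fun z : (EuclideanSpace ℝ (Fin n) ×
      EuclideanSpace ℝ (Fin n)) × ℝ => ENNReal.ofReal (z.2 ^ ((1 - s) * (p - 1))) *
        (ENNReal.ofReal (‖z.1.2 - z.1.1‖ ^ ((1 - s) * p - n)) *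
        PhiD n R p H (z.1.1 + (z.2 / 2) • (z.1.2 - z.1.1), z.2 * ‖z.1.2 - z.1.1‖ / 2))) ?_
  fun_prop

lemma Aint_eq {n : ℕ} {R s p : ℝ} {H : EuclideanSpace ℝ (Fin (n + 1)) → ℝ}
    {x y : EuclideanSpace ℝ (Fin n)} (hx : x ∈ ball (0 : EuclideanSpace ℝ (Fin n)) R)
    (hy : y ∈ ball (0 : EuclideanSpace ℝ (Fin n)) R) (hxy : x ≠ y) :
    Aint n R s p H x y = ∫⁻ τ in Ioo (0:ℝ) 1,
      ENNReal.ofReal (τ ^ ((1 - s) * (p - 1))) * (ENNReal.ofReal (‖y - x‖ ^ ((1 - s) * p - n)) *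
        ENNReal.ofReal (H (emb (x + (τ / 2) • (y - x)) (τ * ‖y - x‖ / 2))) ^ p) := by
  have hr : 0 < ‖y - x‖ := norm_pos_iff.2 (sub_ne_zero.2 hxy.symm)
  have hr2 := dist_lt_two hx hy
  refine setLIntegral_congr_fun measurableSet_Ioo fun τ hτ => ?_
  have h0 := hτ.1
  have h1 := hτ.2
  have hmem : (x + (τ / 2) • (y - x), τ * ‖y - x‖ / 2) ∈
      ball (0 : EuclideanSpace ℝ (Fin n)) R ×ˢ Ioo (0:ℝ) R :=
    ⟨seg_mem_ball hx hy (Ioo_subset_Icc_self hτ), by positivity, by simp only; nlinarith⟩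
  simp only [PhiD, indicator_of_mem hmem]

lemma PhiD_integral {n : ℕ} {R s p : ℝ} {H : EuclideanSpace ℝ (Fin (n + 1)) → ℝ}
    (hHc : ContinuousOn H (cylinder n R)) :
    ∫⁻ t in Ioi (0:ℝ), ENNReal.ofReal (t ^ ((1 - s) * p - 1)) *
        ∫⁻ x : EuclideanSpace ℝ (Fin n), PhiD n R p H (x, t)
    = ∫⁻ x in ball (0 : EuclideanSpace ℝ (Fin n)) R, ∫⁻ t in Ioo (0:ℝ) R,
        ENNReal.ofReal (t ^ ((1 - s) * p - 1)) * ENNReal.ofReal (H (emb x t)) ^ p := by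
  have hm := measurable_PhiD (p := p) hHc
  have e1 : ∀ t, ENNReal.ofReal (t ^ ((1 - s) * p - 1)) *
        ∫⁻ x : EuclideanSpace ℝ (Fin n), PhiD n R p H (x, t) =
      ∫⁻ x : EuclideanSpace ℝ (Fin n),
        ENNReal.ofReal (t ^ ((1 - s) * p - 1)) * PhiD n R p H (x, t) := fun t => by
    rw [lintegral_const_mul _ (by fun_prop)]
  simp_rw [e1]
  rw [lintegral_lintegral_swap (by fun_prop), ← lintegral_indicator measurableSet_ball]
  refine lintegral_congr fun x => ?_
  by_cases hx : x ∈ ball (0 : EuclideanSpace ℝ (Fin n)) R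
  · rw [indicator_of_mem hx, ← lintegral_indicator measurableSet_Ioi,
      ← lintegral_indicator measurableSet_Ioo]
    refine lintegral_congr fun t => ?_
    by_cases ht : t ∈ Ioo (0:ℝ) R
    · have hmem : (x, t) ∈ ball (0 : EuclideanSpace ℝ (Fin n)) R ×ˢ Ioo (0:ℝ) R := ⟨hx, ht⟩
      rw [indicator_of_mem ht, indicator_of_mem (show t ∈ Ioi (0:ℝ) from ht.1)]
      simp only [PhiD, indicator_of_mem hmem]
    · have hmem : (x, t) ∉ ball (0 : EuclideanSpace ℝ (Fin n)) R ×ˢ Ioo (0:ℝ) R :=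
        fun h => ht h.2
      rw [indicator_of_notMem ht]
      simp [PhiD, indicator_of_notMem hmem]
  · rw [indicator_of_notMem hx]
    have : ∀ t, (x, t) ∉ ball (0 : EuclideanSpace ℝ (Fin n)) R ×ˢ Ioo (0:ℝ) R :=
      fun t h => hx h.1
    simp only [PhiD, indicator_of_notMem (this _), mul_zero, lintegral_zero]

/-- The final constant. -/
noncomputable def Ctot (n : ℕ) (s p : ℝ) : ℝ≥0∞ :=
  kap s p * (2 * ((volume : Measure (EuclideanSpace ℝ (Fin n))).toSphere univ *
        ENNReal.ofReal (2 ^ ((1 - s) * p) * (1 / s)) * 2 ^ (p - 1)))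

lemma Ctot_ne_top {n : ℕ} {s p : ℝ} (hp : 1 ≤ p) : Ctot n s p ≠ ⊤ := by
  have : (2 : ℝ≥0∞) ^ (p - 1) ≠ ⊤ := ENNReal.rpow_ne_top_of_nonneg (by linarith) (by simp)
  exact ENNReal.mul_ne_top (kap_ne_top hp) (ENNReal.mul_ne_top (by simp)
    (ENNReal.mul_ne_top (ENNReal.mul_ne_top (measure_ne_top _ _) ENNReal.ofReal_ne_top) this))


/-- Local version of the gauge-covariant fractional trace estimate on a
cylinder `B_R × (0,R)`, with a constant depending only on `n`, `s`, `p` (not on `R`). -/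
theorem trace_gagliardo_estimate_local
    {F : Type*} [NormedAddCommGroup F] [InnerProductSpace ℝ F] [FiniteDimensional ℝ F]
    (n : ℕ) (hn : 1 ≤ n) (s p : ℝ) (hs0 : 0 < s) (hs1 : s < 1) (hp : 1 ≤ p) :
    ∃ C : ℝ, 0 < C ∧
      ∀ R : ℝ, 0 < R →
      ∀ (Γ : EuclideanSpace ℝ (Fin (n + 1)) →
          EuclideanSpace ℝ (Fin (n + 1)) →L[ℝ] F →L[ℝ] F)
        (DΓ : EuclideanSpace ℝ (Fin (n + 1)) →
          EuclideanSpace ℝ (Fin (n + 1)) →L[ℝ] EuclideanSpace ℝ (Fin (n + 1)) →L[ℝ] F →L[ℝ] F),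
        -- Γ of class C¹ on the closed cylinder, with skew-adjoint values
        (∀ z ∈ closedCylinder n R, HasFDerivWithinAt Γ (DΓ z) (closedCylinder n R) z) →
        ContinuousOn Γ (closedCylinder n R) →
        ContinuousOn DΓ (closedCylinder n R) →
        (∀ z ∈ closedCylinder n R, ∀ (v : EuclideanSpace ℝ (Fin (n + 1))) (u w : F),
          ⟪(Γ z v) u, w⟫ = -⟪u, (Γ z v) w⟫) →
        -- β bounds the curvature K_Γ on B_R × (0,R)
        ∀ β : ℝ,
        (∀ x ∈ ball (0 : EuclideanSpace ℝ (Fin n)) R, ∀ t ∈ Ioo (0:ℝ) R,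
          ∀ v w : EuclideanSpace ℝ (Fin (n + 1)),
          ‖((DΓ (emb x t)) v) w - ((DΓ (emb x t)) w) v
            + ((Γ (emb x t)) v).comp ((Γ (emb x t)) w)
            - ((Γ (emb x t)) w).comp ((Γ (emb x t)) v)‖ ≤ β * ‖v‖ * ‖w‖) →
        -- U of class C¹ on B_R × [0,R]
        ∀ (U : EuclideanSpace ℝ (Fin (n + 1)) → F)
          (DU : EuclideanSpace ℝ (Fin (n + 1)) → EuclideanSpace ℝ (Fin (n + 1)) →L[ℝ] F),
        (∀ z ∈ cylinder n R, HasFDerivWithinAt U (DU z) (cylinder n R) z) →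
        ContinuousOn DU (cylinder n R) →
        -- Rt x y is the parallel transport R^{Γ∥}(x,y) along the boundary segment
        ∀ Rt : EuclideanSpace ℝ (Fin n) → EuclideanSpace ℝ (Fin n) → F →L[ℝ] F,
        (∀ x ∈ ball (0 : EuclideanSpace ℝ (Fin n)) R,
         ∀ y ∈ ball (0 : EuclideanSpace ℝ (Fin n)) R, ∃ P : ℝ → F →L[ℝ] F,
          P 1 = ContinuousLinearMap.id ℝ F ∧
          (∀ t ∈ Icc (0:ℝ) 1, HasDerivWithinAt P
            (-((Γ (emb ((1 - t) • x + t • y) 0)) (emb (y - x) 0)).comp (P t))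
            (Icc (0:ℝ) 1) t) ∧
          Rt x y = P 0) →
        (∫⁻ x in ball (0 : EuclideanSpace ℝ (Fin n)) R,
          ∫⁻ y in ball (0 : EuclideanSpace ℝ (Fin n)) R,
            ENNReal.ofReal (‖U (emb x 0) - (Rt x y) (U (emb y 0))‖ ^ p
              / ‖x - y‖ ^ ((n : ℝ) + s * p)))
          ≤ ENNReal.ofReal C *
            ∫⁻ x in ball (0 : EuclideanSpace ℝ (Fin n)) R, ∫⁻ t in Ioo (0:ℝ) R,
              ENNReal.ofReal
                ((hsNorm (DU (emb x t) + (Γ (emb x t)).flip (U (emb x t))) ^ p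
                  + β ^ (p / 2) * ‖U (emb x t)‖ ^ p) / t ^ (1 - (1 - s) * p)) := by
  refine ⟨(Ctot n s p).toReal + 1, by positivity, ?_⟩
  intro R hR Γ DΓ hΓ hΓc hDΓc hskew β hβ U DU hU hDUc Rt hRt
  have hCle : Ctot n s p ≤ ENNReal.ofReal ((Ctot n s p).toReal + 1) := by
    rw [← ENNReal.ofReal_toReal (Ctot_ne_top (n := n) (s := s) hp)]
    refine ENNReal.ofReal_le_ofReal ?_
    rw [ENNReal.toReal_ofReal ENNReal.toReal_nonneg]
    linarith
  -- β is nonnegative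
  have hβ0 : 0 ≤ β := by
    have h1 := hβ 0 (mem_ball_self hR) (R / 2) ⟨by linarith, by linarith⟩
      (EuclideanSpace.single 0 1) (EuclideanSpace.single 0 1)
    have h2 := (norm_nonneg _).trans h1
    simpa using h2
  have hUc : ContinuousOn U (cylinder n R) := fun z hz => (hU z hz).continuousWithinAt
  have hsub : cylinder n R ⊆ closedCylinder n R := by
    rintro z ⟨x, hx, t, ht, rfl⟩
    exact ⟨x, ball_subset_closedBall hx, t, ht, rfl⟩
  obtain ⟨H, hH⟩ : ∃ H : EuclideanSpace ℝ (Fin (n + 1)) → ℝ,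
      H = fun z => hsNorm (DU z + (Γ z).flip (U z)) + √β * ‖U z‖ := ⟨_, rfl⟩
  have hfl : ContinuousOn (fun z => (Γ z).flip (U z)) (cylinder n R) := by
    have h1 : ContinuousOn (fun z => (Γ z).flip) (cylinder n R) :=
      (ContinuousLinearMap.flipₗᵢ ℝ (EuclideanSpace ℝ (Fin (n + 1))) F
        F).continuous.comp_continuousOn (hΓc.mono hsub)
    exact h1.clm_apply hUc
  have hHc : ContinuousOn H (cylinder n R) := by
    rw [hH]
    exact (continuous_hsNorm.comp_continuousOn (hDUc.add hfl)).add
      (continuousOn_const.mul hUc.norm)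
  have hH0 : ∀ z, 0 ≤ H z := by
    intro z
    rw [hH]
    have := hsNorm_nonneg (DU z + (Γ z).flip (U z))
    positivity
  have hAm := measurable_Aint (s := s) (p := p) hHc
  -- pointwise estimate
  have hpt : ∀ x ∈ ball (0 : EuclideanSpace ℝ (Fin n)) R,
      ∀ y ∈ ball (0 : EuclideanSpace ℝ (Fin n)) R,
      ENNReal.ofReal (‖U (emb x 0) - (Rt x y) (U (emb y 0))‖ ^ p
              / ‖x - y‖ ^ ((n : ℝ) + s * p)) ≤
        kap s p * (Aint n R s p H x y + Aint n R s p H y x) := by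
    intro x hx y hy
    by_cases hxy : x = y
    · have hne : (n : ℝ) + s * p ≠ 0 := by positivity
      rw [hxy, sub_self, norm_zero, Real.zero_rpow hne, div_zero, ENNReal.ofReal_zero]
      exact zero_le
    obtain ⟨P, hP1, hP, hRP⟩ := hRt x hx y hy
    have hr : 0 < ‖y - x‖ := norm_pos_iff.2 (sub_ne_zero.2 (Ne.symm hxy))
    have hmain := pw_final hR hΓ hΓc hDΓc hskew hβ0 hβ hU hH hHc hx hy hxy hP1 hP
    have c1 := seg_continuous hR hHc hx hy
    have c2 := seg_continuous hR hHc hy hx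
    rw [norm_sub_rev x y] at c2
    have := pw_pow (e := (n : ℝ) + s * p) (b := (1 - s) * p - n) hs0 hp hr (by ring)
      (norm_nonneg _) c1 c2 (fun _ => hH0 _) (fun _ => hH0 _) hmain
    rw [Aint_eq hx hy hxy, Aint_eq hy hx (Ne.symm hxy), hRP, norm_sub_rev x y]
    exact this
  have hJ := core_double hn (p := p) hs0 (measurable_PhiD (p := p) hHc)
  rw [PhiD_integral hHc] at hJ
  change ∫⁻ x : EuclideanSpace ℝ (Fin n), ∫⁻ y : EuclideanSpace ℝ (Fin n),
    Aint n R s p H x y = _ at hJ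
  have hswap : ∫⁻ x : EuclideanSpace ℝ (Fin n), ∫⁻ y : EuclideanSpace ℝ (Fin n),
      Aint n R s p H y x = ∫⁻ x : EuclideanSpace ℝ (Fin n), ∫⁻ y : EuclideanSpace ℝ (Fin n),
      Aint n R s p H x y :=
    lintegral_lintegral_swap (f := fun x y => Aint n R s p H y x)
      (hAm.comp measurable_swap).aemeasurable
  have hlast : ∫⁻ x in ball (0 : EuclideanSpace ℝ (Fin n)) R, ∫⁻ t in Ioo (0:ℝ) R,
        ENNReal.ofReal (t ^ ((1 - s) * p - 1)) * ENNReal.ofReal (H (emb x t)) ^ p ≤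
      2 ^ (p - 1) * ∫⁻ x in ball (0 : EuclideanSpace ℝ (Fin n)) R, ∫⁻ t in Ioo (0:ℝ) R,
              ENNReal.ofReal
                ((hsNorm (DU (emb x t) + (Γ (emb x t)).flip (U (emb x t))) ^ p
                  + β ^ (p / 2) * ‖U (emb x t)‖ ^ p) / t ^ (1 - (1 - s) * p)) := by
    have h2 : (2 : ℝ≥0∞) ^ (p - 1) ≠ ⊤ := ENNReal.rpow_ne_top_of_nonneg (by linarith) (by simp)
    rw [← lintegral_const_mul' _ _ h2]
    refine lintegral_mono fun x => ?_
    rw [← lintegral_const_mul' _ _ h2]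
    refine setLIntegral_mono' measurableSet_Ioo fun t ht => ?_
    rw [hH]
    exact fin_pow hp ht.1 (hsNorm_nonneg _) (norm_nonneg _) hβ0
  calc _ ≤ ∫⁻ x in ball (0 : EuclideanSpace ℝ (Fin n)) R,
          ∫⁻ y in ball (0 : EuclideanSpace ℝ (Fin n)) R,
            kap s p * (Aint n R s p H x y + Aint n R s p H y x) :=
        setLIntegral_mono' measurableSet_ball fun x hx =>
          setLIntegral_mono' measurableSet_ball fun y hy => hpt x hx y hy
    _ ≤ ∫⁻ x : EuclideanSpace ℝ (Fin n), ∫⁻ y : EuclideanSpace ℝ (Fin n),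
            kap s p * (Aint n R s p H x y + Aint n R s p H y x) :=
        (setLIntegral_le_lintegral _ _).trans
          (lintegral_mono fun x => setLIntegral_le_lintegral _ _)
    _ = kap s p * (2 * ∫⁻ x : EuclideanSpace ℝ (Fin n), ∫⁻ y : EuclideanSpace ℝ (Fin n),
            Aint n R s p H x y) := by
        simp_rw [lintegral_const_mul' _ _ (kap_ne_top (s := s) hp)]
        have h1 : ∀ x : EuclideanSpace ℝ (Fin n), ∫⁻ y : EuclideanSpace ℝ (Fin n),
            (Aint n R s p H x y + Aint n R s p H y x) =
            (∫⁻ y : EuclideanSpace ℝ (Fin n), Aint n R s p H x y) +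
            ∫⁻ y : EuclideanSpace ℝ (Fin n), Aint n R s p H y x := fun x =>
          lintegral_add_left (hAm.comp measurable_prodMk_left) _
        simp_rw [h1]
        rw [lintegral_add_left hAm.lintegral_prod_right', hswap, two_mul]
    _ ≤ Ctot n s p * _ := by
        rw [hJ]
        refine (mul_le_mul_right (mul_le_mul_right (mul_le_mul_right hlast _) _) _).trans
          (le_of_eq ?_)
        unfold Ctot
        ring
    _ ≤ _ := mul_le_mul_left hCle _
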